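/- Let n ≥ 2, q ∈ (1,2), p = q/(q−1), α ∈ (0,1), Ω ⊂ ℝⁿ bounded open, and let u ∈ W^{1,q}_loc(Ω) be a local weak solution of −div((|∇u|−1)_+^{q−1} ∇u/|∇u|) = f. Then: (i) if f ∈ W^{1,p}_loc(Ω), then ∇u ∈ L^r_loc(Ω) for all r ∈ [1, nq(3−q)/(n(3−q)−2)); (ii) if f ∈ B^α_{p,∞,loc}(Ω), then ∇u ∈ L^s_loc(Ω) for all s < nq/(n−α−1) when 0 < α < (q−1)/(3−q), and for all s < nq(3−q)/(n(3−q)−2) when (q−1)/(3−q) ≤ α < 1. -/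

import Mathlib

open MeasureTheory Metric
open scoped RealInnerProductSpace ENNReal

/-- `H_a(ξ) = (|ξ|−1)_+^a ξ/|ξ|` (with value `0` at `ξ = 0`). -/
noncomputable def Hmap (n : ℕ) (a : ℝ) (ξ : EuclideanSpace ℝ (Fin n)) :
    EuclideanSpace ℝ (Fin n) :=
  ((max (‖ξ‖ - 1) 0) ^ a / ‖ξ‖) • ξ

/-- The `s`-th standard unit vector `e_s` of `ℝⁿ`. -/
noncomputable def unitVec (n : ℕ) (s : Fin n) : EuclideanSpace ℝ (Fin n) :=
  EuclideanSpace.single s 1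

/-- `u ∈ W^{1,q}_loc(Ω)` with weak gradient `Du`: local `L^q` integrability of `u` and `Du`,
together with the integration-by-parts identity against test functions supported in `Ω`. -/
def MemW1Loc (n : ℕ) (q : ℝ) (Ω : Set (EuclideanSpace ℝ (Fin n)))
    (u : EuclideanSpace ℝ (Fin n) → ℝ)
    (Du : EuclideanSpace ℝ (Fin n) → EuclideanSpace ℝ (Fin n)) : Prop :=
  (∀ K : Set (EuclideanSpace ℝ (Fin n)), IsCompact K → K ⊆ Ω →
      MemLp u (ENNReal.ofReal q) (volume.restrict K) ∧
      MemLp Du (ENNReal.ofReal q) (volume.restrict K)) ∧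
  (∀ φ : EuclideanSpace ℝ (Fin n) → ℝ, ContDiff ℝ 1 φ → HasCompactSupport φ →
      tsupport φ ⊆ Ω →
      ∫ x in Ω, u x • gradient φ x = -∫ x in Ω, φ x • Du x)

/-- `u` (with gradient `Du`) is a local weak solution of
`−div((|∇u|−1)_+^{q−1} ∇u/|∇u|) = f` in `Ω`:
`∫_Ω ⟨H_{q−1}(∇u), ∇φ⟩ = ∫_Ω f φ` for all test functions `φ` supported in `Ω`. -/
def IsLocalWeakSolution (n : ℕ) (q : ℝ) (Ω : Set (EuclideanSpace ℝ (Fin n)))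
    (Du : EuclideanSpace ℝ (Fin n) → EuclideanSpace ℝ (Fin n))
    (f : EuclideanSpace ℝ (Fin n) → ℝ) : Prop :=
  ∀ φ : EuclideanSpace ℝ (Fin n) → ℝ, ContDiff ℝ 1 φ → HasCompactSupport φ →
    tsupport φ ⊆ Ω →
    ∫ x in Ω, ⟪Hmap n (q - 1) (Du x), gradient φ x⟫ = ∫ x in Ω, f x * φ x

/-- The set of Besov difference quotients of `f` on the set `B`:
`(∫_B |f(x+h e_s) − f(x)|^p / |h|^{αp} dx)^{1/p}` over directions `s` and `h ≠ 0`. -/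
def besovSet (n : ℕ) (p α : ℝ) (B : Set (EuclideanSpace ℝ (Fin n)))
    (f : EuclideanSpace ℝ (Fin n) → ℝ) : Set ℝ :=
  {t : ℝ | ∃ (s : Fin n) (h : ℝ), h ≠ 0 ∧
    t = (∫ x in B, |f (x + h • unitVec n s) - f x| ^ p / |h| ^ (α * p)) ^ (1 / p)}

/-- The Besov norm `‖f‖_{B^α_{p,∞}(B)} = ‖f‖_{L^p(B)} + sup_{h≠0} (...)^{1/p}`. -/
noncomputable def besovNormBall (n : ℕ) (p α : ℝ) (B : Set (EuclideanSpace ℝ (Fin n)))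
    (f : EuclideanSpace ℝ (Fin n) → ℝ) : ℝ :=
  (∫ x in B, |f x| ^ p) ^ (1 / p) + sSup (besovSet n p α B f)

/-- `f ∈ B^α_{p,∞,loc}(Ω)`: on every ball compactly contained in `Ω`, `f ∈ L^p` and the
Besov difference quotients are bounded. -/
def MemBesovLoc (n : ℕ) (p α : ℝ) (Ω : Set (EuclideanSpace ℝ (Fin n)))
    (f : EuclideanSpace ℝ (Fin n) → ℝ) : Prop :=
  ∀ (z : EuclideanSpace ℝ (Fin n)) (r : ℝ), 0 < r → closedBall z r ⊆ Ω →
    IntegrableOn (fun x => |f x| ^ p) (ball z r) volume ∧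
    BddAbove (besovSet n p α (ball z r) f)


lemma real_add_rpow {x y p : ℝ} (hx : 0 ≤ x) (hy : 0 ≤ y) (hp : 1 ≤ p) :
    (x + y)^p ≤ 2^(p-1) * (x^p + y^p) := by
  have := NNReal.rpow_add_le_mul_rpow_add_rpow ⟨x, hx⟩ ⟨y, hy⟩ hp
  exact_mod_cast this

lemma aux_b {q a b c : ℝ} (hq1 : 1 < q) (hq2 : q < 2) (hc : c ≤ 1) (hab : b ≤ a) (hb : 0 ≤ b) :
    ((max (a-1) 0)^(q/2) - (max (b-1) 0)^(q/2))^2 ≤ 1/(q-1) *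
      ((max (a-1) 0)^(q-1) * a + (max (b-1) 0)^(q-1) * b
        - ((max (a-1) 0)^(q-1) * b + (max (b-1) 0)^(q-1) * a) * c) := by
  set s := max (a-1) 0 with hs
  set t := max (b-1) 0 with ht
  have hs0 : 0 ≤ s := le_max_right _ _
  have ht0 : 0 ≤ t := le_max_right _ _
  have hts : t ≤ s := max_le_max (by linarith) le_rfl
  have hst : s - t ≤ a - b := by
    rcases max_cases (a-1) 0 with h | h <;> rcases max_cases (b-1) 0 with h' | h' <;> 
      simp only [← hs, ← ht] at h h' <;> linarith
  have hA : 0 ≤ s^(q-1) := by positivity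
  have hB : 0 ≤ t^(q-1) := by positivity
  have hAB : t^(q-1) ≤ s^(q-1) := Real.rpow_le_rpow ht0 hts (by linarith)
  have key : (s^(q/2) - t^(q/2))^2 ≤ 1/(q-1) * ((s^(q-1) - t^(q-1)) * (s - t)) := by
    rcases hs0.eq_or_lt with h0 | h0
    · have : t = 0 := by linarith
      rw [this, ← h0]; simp
    · set x := t / s with hx
      have hx0 : 0 ≤ x := by positivity
      have hx1 : x ≤ 1 := by rw [hx, div_le_one h0]; exact hts
      have htx : t = s * x := by rw [hx]; field_simp
      have e1 : x ≤ x^(q/2) := by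
        calc x = x^(1:ℝ) := by simp
          _ ≤ _ := Real.rpow_le_rpow_of_exponent_ge' hx0 hx1 (by linarith) (by linarith)
      have e1' : x^(q/2) ≤ 1 := Real.rpow_le_one hx0 hx1 (by linarith)
      have e2 : x^(q-1) ≤ 1 + (q-1)*(x-1) := by
        have := rpow_one_add_le_one_add_mul_self (s := x - 1) (by linarith) (p := q-1) (by linarith) (by linarith)
        simpa using this
      have e3 : (1 - x^(q/2))^2 ≤ 1/(q-1) * ((1 - x^(q-1)) * (1-x)) := by
        have : (1 - x^(q/2))^2 ≤ (1-x)^2 := by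
          apply pow_le_pow_left₀ <;> linarith
        have h2 : (q-1)*(1-x)*(1-x) ≤ (1 - x^(q-1)) * (1-x) := by
          apply mul_le_mul_of_nonneg_right <;> linarith
        rw [one_div, inv_mul_eq_div, le_div_iff₀ (by linarith)]
        nlinarith
      rw [htx, Real.mul_rpow hs0 hx0, Real.mul_rpow hs0 hx0]
      have e4 : s^(q/2) * s^(q/2) = s^(q-1) * s := by
        rw [← Real.rpow_add h0, ← Real.rpow_add_one h0.ne']; congr 1; ring
      have : (s^(q/2) - s^(q/2) * x^(q/2))^2 = (s^(q-1) * s) * (1 - x^(q/2))^2 := by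
        rw [← e4]; ring
      rw [this]
      calc _ ≤ (s^(q-1) * s) * (1/(q-1) * ((1 - x^(q-1)) * (1-x))) := by gcongr
        _ = _ := by ring
  refine key.trans ?_
  have : 0 ≤ 1/(q-1) := by apply one_div_nonneg.2; linarith
  apply mul_le_mul_of_nonneg_left _ this
  have h1 : (s^(q-1) - t^(q-1)) * (s - t) ≤ (s^(q-1) - t^(q-1)) * (a - b) := by
    apply mul_le_mul_of_nonneg_left hst; linarith
  have h2 : 0 ≤ (s^(q-1) * b + t^(q-1) * a) * (1 - c) := by
    apply mul_nonneg
    · have : 0 ≤ a := by linarith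
      positivity
    · linarith
  nlinarith

lemma aux_a {q p a b c : ℝ} (hq1 : 1 < q) (hq2 : q < 2) (hp : p = q / (q-1)) (hc : c ≤ 1) (hc' : -1 ≤ c) (hab : b ≤ a) (hb : 0 ≤ b) :
    (((max (a-1) 0)^(q-1))^2 + ((max (b-1) 0)^(q-1))^2 - 2 * ((max (a-1) 0)^(q-1) * (max (b-1) 0)^(q-1)) * c)^(p/2) ≤ 
    2^(p/2-1) * 4 ^(p/2-1) *
      ((max (a-1) 0)^(q-1) * a + (max (b-1) 0)^(q-1) * b
        - ((max (a-1) 0)^(q-1) * b + (max (b-1) 0)^(q-1) * a) * c) := by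
  set s := max (a-1) 0 with hs
  set t := max (b-1) 0 with ht
  have hq0 : 0 < q - 1 := by linarith
  have hp2 : 2 ≤ p := by rw [hp, le_div_iff₀ hq0]; linarith
  have hpq : (q-1) * p = q := by rw [hp]; field_simp
  have hs0 : 0 ≤ s := le_max_right _ _
  have ht0 : 0 ≤ t := le_max_right _ _
  have hts : t ≤ s := max_le_max (by linarith) le_rfl
  have hta : s ≤ a := max_le (by linarith) (by linarith)
  have htb : t ≤ b := max_le (by linarith) (by linarith)
  have hst : s - t ≤ a - b := by
    rcases max_cases (a-1) 0 with h | h <;> rcases max_cases (b-1) 0 with h' | h' <;> 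
      simp only [← hs, ← ht] at h h' <;> linarith
  set A := s^(q-1) with hA'
  set B := t^(q-1) with hB'
  have hA : 0 ≤ A := by positivity
  have hB : 0 ≤ B := by positivity
  have hAB : B ≤ A := Real.rpow_le_rpow ht0 hts (by linarith)
  have hX : ((A-B)^2)^(p/2) ≤ (A-B)*(a-b) := by
    have h0 : 0 ≤ A - B := by linarith
    have : ((A-B)^2)^(p/2) = (A-B)^p := by
      rw [← Real.rpow_natCast, ← Real.rpow_mul h0]; congr 1; push_cast; ring
    rw [this]
    have e : (A-B)^p = (A-B) * (A-B)^(p-1) := by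
      rw [← Real.rpow_one_add' h0 (by linarith)]; congr 1; ring
    rw [e]
    apply mul_le_mul_of_nonneg_left _ h0
    refine le_trans ?_ hst
    have h1 : A - B ≤ (s-t)^(q-1) := by
      have := Real.rpow_add_le_add_rpow (p := q-1) ht0 (sub_nonneg.2 hts) (by linarith) (by linarith)
      rw [add_sub_cancel] at this
      linarith
    calc (A-B)^(p-1) ≤ ((s-t)^(q-1))^(p-1) := Real.rpow_le_rpow h0 h1 (by linarith)
      _ = s - t := by
        rw [← Real.rpow_mul (sub_nonneg.2 hts)]
        have : (q-1)*(p-1) = 1 := by linarith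
        rw [this, Real.rpow_one]
  have hY : (2*(A*B)*(1-c))^(p/2) ≤ 4^(p/2-1) * ((A*b+B*a)*(1-c)) := by
    have hd : 0 ≤ 1 - c := by linarith
    have e1 : (2*(A*B)*(1-c)) = (A*B) * (2*(1-c)) := by ring
    rw [e1, Real.mul_rpow (by positivity) (by positivity)]
    have e2 : (2*(1-c))^(p/2) ≤ 4^(p/2-1) * (2*(1-c)) := by
      have h0 : 0 ≤ 2*(1-c) := by linarith
      have : (2*(1-c))^(p/2) = (2*(1-c))^(p/2-1) * (2*(1-c)) := by
        rw [← Real.rpow_add_one' h0 (by linarith)]; congr 1; ring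
      rw [this]
      apply mul_le_mul_of_nonneg_right _ h0
      apply Real.rpow_le_rpow h0 (by linarith) (by linarith)
    have e3 : 2 * (A*B)^(p/2) ≤ A*b + B*a := by
      have h1 : (A*B)^(p/2) = s^(q/2) * t^(q/2) := by
        rw [Real.mul_rpow hA hB, hA', hB', ← Real.rpow_mul hs0, ← Real.rpow_mul ht0]
        have : (q-1)*(p/2) = q/2 := by linarith
        rw [this]
      have h2 : A*t + B*s ≤ A*b+B*a := by gcongr
      refine le_trans ?_ h2
      rw [h1]
      have hAs : A * s = (s^(q/2))^2 := by
        rw [hA', ← Real.rpow_add_one' hs0 (by linarith), ← Real.rpow_natCast, ← Real.rpow_mul hs0]; congr 1; push_cast; ring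
      have hBt : B * t = (t^(q/2))^2 := by
        rw [hB', ← Real.rpow_add_one' ht0 (by linarith), ← Real.rpow_natCast, ← Real.rpow_mul ht0]; congr 1; push_cast; ring
      have h3 : (A*t) * (B*s) = (s^(q/2) * t^(q/2))^2 := by
        rw [mul_pow, ← hAs, ← hBt]; ring
      have h4 : 0 ≤ s^(q/2) * t^(q/2) := by positivity
      have h5 : 0 ≤ A*t + B*s := by positivity
      refine le_of_sq_le_sq ?_ h5
      nlinarith [sq_nonneg (A*t - B*s)]
    calc _ ≤ (A*B)^(p/2) * (4^(p/2-1) * (2*(1-c))) := by gcongr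
      _ = 4^(p/2-1) * ((2 * (A*B)^(p/2)) * (1-c)) := by ring
      _ ≤ _ := by gcongr
  have e : A^2+B^2-2*(A*B)*c = (A-B)^2 + 2*(A*B)*(1-c) := by ring
  rw [e]
  have hd : 0 ≤ 1 - c := by linarith
  have h4 : (1:ℝ) ≤ 4^(p/2-1) := Real.one_le_rpow (by norm_num) (by linarith)
  calc _ ≤ 2^(p/2-1) * (((A-B)^2)^(p/2) + (2*(A*B)*(1-c))^(p/2)) :=
        real_add_rpow (by positivity) (by positivity) (by linarith)
    _ ≤ 2^(p/2-1) * (4^(p/2-1) * ((A-B)*(a-b)) + 4^(p/2-1) * ((A*b+B*a)*(1-c))) := by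
        gcongr
        refine hX.trans (le_mul_of_one_le_left ?_ h4)
        apply mul_nonneg <;> linarith
    _ = _ := by ring

lemma Hmap_repr (n : ℕ) {r : ℝ} (hr : 0 < r) (ξ η : EuclideanSpace ℝ (Fin n)) :
    ∃ c : ℝ, c ≤ 1 ∧ -1 ≤ c ∧
      ⟪Hmap n r ξ - Hmap n r η, ξ - η⟫ = 
        ((max (‖ξ‖-1) 0)^r * ‖ξ‖ + (max (‖η‖-1) 0)^r * ‖η‖
        - ((max (‖ξ‖-1) 0)^r * ‖η‖ + (max (‖η‖-1) 0)^r * ‖ξ‖) * c) ∧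
      ‖Hmap n r ξ - Hmap n r η‖^2 = 
        ((max (‖ξ‖-1) 0)^r)^2 + ((max (‖η‖-1) 0)^r)^2 - 2 * ((max (‖ξ‖-1) 0)^r * (max (‖η‖-1) 0)^r) * c := by
  have hz : ∀ ξ : EuclideanSpace ℝ (Fin n), ‖ξ‖ = 0 → (max (‖ξ‖-1) 0)^r = 0 := by
    intro ξ h
    rw [h, max_eq_right (by norm_num), Real.zero_rpow hr.ne']
  set A := (max (‖ξ‖-1) 0)^r with hA
  set B := (max (‖η‖-1) 0)^r with hB
  have hA0 := hz ξ
  have hB0 := hz η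
  rw [← hA] at hA0
  rw [← hB] at hB0
  have h1 : Hmap n r ξ = (A/‖ξ‖) • ξ := rfl
  have h2 : Hmap n r η = (B/‖η‖) • η := rfl
  have e1 : A / ‖ξ‖ * ‖ξ‖ = A := by
    by_cases h : ‖ξ‖ = 0
    · rw [hA0 h]; simp
    · field_simp
  have e2 : B / ‖η‖ * ‖η‖ = B := by
    by_cases h : ‖η‖ = 0
    · rw [hB0 h]; simp
    · field_simp
  have hcs := abs_real_inner_div_norm_mul_norm_le_one ξ η
  set c := ⟪ξ, η⟫ / (‖ξ‖ * ‖η‖) with hc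
  have e3 : ⟪ξ, η⟫ = ‖ξ‖ * ‖η‖ * c := by
    by_cases h : ‖ξ‖ = 0
    · rw [norm_eq_zero] at h; simp [h]
    by_cases h' : ‖η‖ = 0
    · rw [norm_eq_zero] at h'; simp [h']
    rw [hc]; field_simp
  refine ⟨c, (abs_le.1 hcs).2, (abs_le.1 hcs).1, ?_, ?_⟩
  · rw [h1, h2]
    simp only [inner_sub_left, inner_sub_right, real_inner_smul_left, real_inner_self_eq_norm_sq]
    rw [real_inner_comm ξ η, e3]
    linear_combination (‖ξ‖ - ‖η‖ * c) * e1 + (‖η‖ - ‖ξ‖*c) * e2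
  · rw [← real_inner_self_eq_norm_sq, h1, h2]
    simp only [inner_sub_left, inner_sub_right, real_inner_smul_left, real_inner_smul_right]
    rw [real_inner_self_eq_norm_sq, real_inner_self_eq_norm_sq]
    rw [real_inner_comm ξ η, e3]
    linear_combination (A / ‖ξ‖ * ‖ξ‖ + A - 2 * c * (B/‖η‖*‖η‖)) * e1 + (B / ‖η‖ * ‖η‖ + B - 2 * c * A) * e2

/-- the scalar `(|ξ|-1)_+^{q/2}` -/
noncomputable def vmap (n : ℕ) (q : ℝ) (ξ : EuclideanSpace ℝ (Fin n)) : ℝ :=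
  (max (‖ξ‖-1) 0)^(q/2)

lemma mono_b (n : ℕ) {q : ℝ} (hq1 : 1 < q) (hq2 : q < 2) (ξ η : EuclideanSpace ℝ (Fin n)) :
    (vmap n q ξ - vmap n q η)^2 ≤ 1/(q-1) * ⟪Hmap n (q-1) ξ - Hmap n (q-1) η, ξ - η⟫ := by
  wlog h : ‖η‖ ≤ ‖ξ‖ generalizing ξ η
  · have := this η ξ (not_le.1 h).le
    rw [← neg_sub ξ η, ← neg_sub (Hmap n (q-1) ξ), inner_neg_neg] at this
    linarith
  obtain ⟨c, hc, hc', h1, h2⟩ := Hmap_repr n (sub_pos.2 hq1) ξ η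
  rw [h1]
  exact aux_b hq1 hq2 hc h (norm_nonneg _)

lemma mono_a (n : ℕ) {q p : ℝ} (hq1 : 1 < q) (hq2 : q < 2) (hp : p = q/(q-1)) (ξ η : EuclideanSpace ℝ (Fin n)) :
    ‖Hmap n (q-1) ξ - Hmap n (q-1) η‖^p ≤ 2^(p/2-1) * 4 ^(p/2-1) * ⟪Hmap n (q-1) ξ - Hmap n (q-1) η, ξ - η⟫ := by
  wlog h : ‖η‖ ≤ ‖ξ‖ generalizing ξ η
  · have := this η ξ (not_le.1 h).le
    rw [← neg_sub ξ η, ← neg_sub (Hmap n (q-1) ξ), inner_neg_neg, norm_neg] at this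
    linarith
  obtain ⟨c, hc, hc', h1, h2⟩ := Hmap_repr n (sub_pos.2 hq1) ξ η
  have : ‖Hmap n (q-1) ξ - Hmap n (q-1) η‖^p = (‖Hmap n (q-1) ξ - Hmap n (q-1) η‖^2)^(p/2) := by
    rw [← Real.rpow_natCast, ← Real.rpow_mul (norm_nonneg _)]; congr 1; push_cast; ring
  rw [this, h1, h2]
  exact aux_a hq1 hq2 hp hc hc' h (norm_nonneg _)

lemma Hmap_norm_le (n : ℕ) {r : ℝ} (hr : 0 < r) (ξ : EuclideanSpace ℝ (Fin n)) :
    ‖Hmap n r ξ‖ ≤ ‖ξ‖^r := by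
  have h0 : (0:ℝ) ≤ max (‖ξ‖-1) 0 := le_max_right _ _
  rw [Hmap, norm_smul, Real.norm_of_nonneg (by positivity)]
  calc _ ≤ (max (‖ξ‖-1) 0)^r := by
        by_cases h : ‖ξ‖ = 0
        · rw [h]; simp; positivity
        · field_simp; exact le_rfl
    _ ≤ _ := Real.rpow_le_rpow h0 (max_le (by linarith) (norm_nonneg _)) hr.le

lemma Hmap_meas (n : ℕ) (r : ℝ) : Measurable (Hmap n r) := by
  unfold Hmap; fun_prop

lemma vmap_meas (n : ℕ) (r : ℝ) : Measurable (vmap n r) := by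
  unfold vmap; fun_prop

lemma vmap_nonneg (n : ℕ) (q : ℝ) (ξ : EuclideanSpace ℝ (Fin n)) : 0 ≤ vmap n q ξ := by
  have h0 : (0:ℝ) ≤ max (‖ξ‖-1) 0 := le_max_right _ _
  unfold vmap; positivity

lemma vmap_le (n : ℕ) {q : ℝ} (hq : 0 < q) (ξ : EuclideanSpace ℝ (Fin n)) : vmap n q ξ ≤ ‖ξ‖^(q/2) := by
  have h0 : (0:ℝ) ≤ max (‖ξ‖-1) 0 := le_max_right _ _
  unfold vmap
  exact Real.rpow_le_rpow h0 (max_le (by linarith) (norm_nonneg _)) (by linarith)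

lemma norm_le_vmap (n : ℕ) {q : ℝ} (hq : 0 < q) (ξ : EuclideanSpace ℝ (Fin n)) : ‖ξ‖ ≤ 1 + (vmap n q ξ)^(2/q) := by
  have h0 : (0:ℝ) ≤ max (‖ξ‖-1) 0 := le_max_right _ _
  unfold vmap
  rw [← Real.rpow_mul h0]
  have : q/2*(2/q) = 1 := by field_simp
  rw [this, Real.rpow_one]
  linarith [le_max_left (‖ξ‖-1) 0]

lemma young_eps {p q : ℝ} (hpq : p.HolderConjugate q) {c M : ℝ} (hc : 0 < c) (hM : 0 ≤ M) :
    ∃ K : ℝ, 0 ≤ K ∧ ∀ X Y : ℝ, 0 ≤ X → 0 ≤ Y → M * X * Y ≤ c * X^p + K * Y^q := by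
  have hp := hpq.pos
  have hq := hpq.symm.pos
  set ε := (c*p)^(1/p) with hε
  have hε0 : 0 < ε := by positivity
  refine ⟨(M/ε)^q/q, by positivity, fun X Y hX hY => ?_⟩
  have := Real.young_inequality_of_nonneg (a := ε * X) (b := M/ε*Y) (by positivity) (by positivity) hpq
  have e : ε * X * (M/ε*Y) = M*X*Y := by field_simp
  rw [e, Real.mul_rpow hε0.le hX, Real.mul_rpow (by positivity) hY] at this
  have e2 : ε^p = c*p := by
    rw [hε, ← Real.rpow_mul (by positivity)]; field_simp; simp
  rw [e2] at this
  calc _ ≤ _ := this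
    _ = _ := by field_simp


lemma lintegral_eq_eLpNorm_pow {X F : Type*} [MeasurableSpace X] [NormedAddCommGroup F] {μ : Measure X} {f : X → F}
    {q : ℝ} (hq : 0 < q) :
    ∫⁻ x, ‖f x‖ₑ^q ∂μ = (eLpNorm f (ENNReal.ofReal q) μ)^q := by
  rw [eLpNorm_eq_lintegral_rpow_enorm_toReal (by simpa using hq) (by simp), ENNReal.toReal_ofReal hq.le,
    ← ENNReal.rpow_mul, one_div, inv_mul_cancel₀ hq.ne', ENNReal.rpow_one]

/-- iteration of the decay estimate -/
lemma decay_iter {m : ℝ → ℝ} (hm : ∀ l, 0 ≤ m l) {K κ : ℝ} (hK : 0 ≤ K) (hκ0 : 0 < κ) (hκ1 : κ < 1)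
    (h0 : ∀ l, 0 < l → m l ≤ K * l^(-2:ℝ)) (h1 : ∀ l, 0 < l → m l ≤ K * l^(-2:ℝ) * (m (l/2))^κ)
    {e : ℝ} (he : e < 2/(1-κ)) : ∃ C, 0 ≤ C ∧ ∀ l, 1 ≤ l → m l ≤ C * l^(-e) := by
  have step : ∀ k : ℕ, ∃ C, 0 ≤ C ∧ ∀ l, 0 < l → m l ≤ C * l^(-(2*(1-κ^(k+1))/(1-κ))) := by
    intro k
    have hne : 1 - κ ≠ 0 := by linarith
    induction k with
    | zero =>
      refine ⟨K, hK, fun l hl => ?_⟩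
      have : -(2*(1-κ^(0+1))/(1-κ)) = -2 := by simp; field_simp
      rw [this]; exact h0 l hl
    | succ k ih =>
      obtain ⟨C, hC, ih⟩ := ih
      set ek := 2*(1-κ^(k+1))/(1-κ) with hek
      refine ⟨K * (C^κ * (2⁻¹:ℝ)^(-ek*κ)), by positivity, fun l hl => ?_⟩
      calc m l ≤ K * l^(-2:ℝ) * (m (l/2))^κ := h1 l hl
        _ ≤ K * l^(-2:ℝ) * (C * (l/2)^(-ek))^κ := by
          gcongr
          · exact hm _
          · exact ih _ (by positivity)
        _ = K * (C^κ * (2⁻¹:ℝ)^(-ek*κ)) * (l^(-2:ℝ) * l^(-ek*κ)) := by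
          rw [Real.mul_rpow hC (by positivity), ← Real.rpow_mul (by positivity), div_eq_mul_inv,
            Real.mul_rpow hl.le (by positivity)]
          ring
        _ = _ := by
          rw [← Real.rpow_add hl]
          congr 2
          rw [hek]; field_simp; ring
  have hlim : Filter.Tendsto (fun k : ℕ => 2*(1-κ^(k+1))/(1-κ)) Filter.atTop (nhds (2/(1-κ))) := by
    have h := (tendsto_pow_atTop_nhds_zero_of_lt_one hκ0.le hκ1).comp (Filter.tendsto_add_atTop_nat 1)
    have := ((h.const_sub 1).const_mul 2).div_const (1-κ)
    simpa using this
  obtain ⟨k, hk⟩ := (hlim.eventually (lt_mem_nhds he)).exists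
  obtain ⟨C, hC, h⟩ := step k
  refine ⟨C, hC, fun l hl => (h l (by linarith)).trans ?_⟩
  gcongr
 
/-- From decay to integrability. -/
lemma integ_of_decay {X : Type*} [MeasurableSpace X] {μ : Measure X} [IsFiniteMeasure μ] {g : X → ℝ} (hg : Measurable g)
    {e r C : ℝ} (hr : 0 < r) (hre : r < e) (hC : 0 ≤ C)
    (h : ∀ l : ℝ, 1 ≤ l → μ {x | l < |g x|} ≤ ENNReal.ofReal (C * l^(-e))) :
    ∫⁻ x, ENNReal.ofReal (|g x|^r) ∂μ < ⊤ := by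
  rw [lintegral_rpow_eq_lintegral_meas_lt_mul μ (Filter.Eventually.of_forall fun x => abs_nonneg _) hg.abs.aemeasurable hr]
  refine ENNReal.mul_lt_top ENNReal.ofReal_lt_top ?_
  have hsub : Set.Ioi (0:ℝ) ⊆ Set.Ioo 0 2 ∪ Set.Ioi 1 := by
    intro t ht
    by_cases h : t < 2
    · exact Or.inl ⟨ht, h⟩
    · right; simp only [Set.mem_Ioi]; linarith
  refine (lintegral_mono_set hsub).trans_lt ((lintegral_union_le _ _ _).trans_lt (ENNReal.add_lt_top.2 ⟨?_, ?_⟩))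
  · have hi : IntegrableOn (fun t:ℝ => t^(r-1)) (Set.Ioo 0 2) :=
      (intervalIntegral.integrableOn_Ioo_rpow_iff (by norm_num)).2 (by linarith)
    calc _ ≤ ∫⁻ t in Set.Ioo (0:ℝ) 2, μ Set.univ * ENNReal.ofReal (t^(r-1)) := by
          gcongr; exact Set.subset_univ _
      _ = μ Set.univ * ∫⁻ t in Set.Ioo (0:ℝ) 2, ENNReal.ofReal (t^(r-1)) := by
          rw [lintegral_const_mul' _ _ (measure_ne_top _ _)]
      _ < ⊤ := ENNReal.mul_lt_top (measure_lt_top _ _) hi.lintegral_lt_top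
  · have hi : IntegrableOn (fun t:ℝ => C * t^(r-1-e)) (Set.Ioi 1) :=
      (integrableOn_Ioi_rpow_of_lt (by linarith) one_pos).const_mul C
    refine lt_of_le_of_lt ?_ hi.lintegral_lt_top
    refine setLIntegral_mono' measurableSet_Ioi fun t ht => ?_
    have ht' : (1:ℝ) < t := ht
    have ht0 : 0 < t := by linarith
    calc _ ≤ ENNReal.ofReal (C * t^(-e)) * ENNReal.ofReal (t^(r-1)) := by
          gcongr; exact h t ht'.le
      _ = _ := by
        rw [← ENNReal.ofReal_mul (by positivity), mul_assoc, ← Real.rpow_add ht0]; congr 3; ring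

/-- key estimate on distribution functions -/
lemma key_dist (n : ℕ) (hn : 1 ≤ n) {g : EuclideanSpace ℝ (Fin n) → ℝ} (hg : Measurable g)
    {β D : ℝ} (hD : 0 ≤ D) (hβ : 0 < β)
    (hy : ∀ y, ∫⁻ x, ENNReal.ofReal (|g (x+y) - g x|^2) ≤ ENNReal.ofReal (D * ‖y‖^β))
    {l : ℝ} (hl : 0 < l) (hfin : ∀ l : ℝ, 0 < l → volume {x | l < |g x|} ≠ ⊤) :
    volume.real {x | l < |g x|} ≤
      (8 * D * (2 / volume.real (ball (0:EuclideanSpace ℝ (Fin n)) 1))^(β/n)) * l^(-2:ℝ) *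
        (volume.real {x | l/2 < |g x|})^(β/n) := by
  have : Nonempty (Fin n) := ⟨⟨0, hn⟩⟩
  have hn0 : (n:ℝ) ≠ 0 := by positivity
  set μ := volume.real {x | l/2 < |g x|} with hμ
  have hμ0 : 0 ≤ μ := measureReal_nonneg
  have hmono : volume.real {x | l < |g x|} ≤ μ := by
    apply measureReal_mono _ (hfin _ (by positivity))
    intro x hx
    simp only [Set.mem_ofPred_eq] at hx ⊢
    linarith
  rcases hμ0.eq_or_lt with h0 | h0
  · rw [← h0] at hmono
    have : (0:ℝ) ≤ (volume.real (ball (0:EuclideanSpace ℝ (Fin n)) 1)) := measureReal_nonneg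
    refine hmono.trans ?_
    positivity
  set ω := volume.real (ball (0:EuclideanSpace ℝ (Fin n)) 1) with hω
  have hω0 : 0 < ω := by
    rw [hω, measureReal_def]
    exact ENNReal.toReal_pos (measure_ball_pos _ _ one_pos).ne' measure_ball_lt_top.ne
  set ρ := (2*μ/ω)^(1/(n:ℝ)) with hρ
  have hρ0 : 0 < ρ := by positivity
  have hball : volume (ball (0:EuclideanSpace ℝ (Fin n)) ρ) = ENNReal.ofReal (2*μ) := by
    rw [Measure.addHaar_ball _ _ hρ0.le, finrank_euclideanSpace_fin]
    rw [← ENNReal.ofReal_toReal (measure_ball_lt_top (μ := volume) (x := (0:EuclideanSpace ℝ (Fin n))) (r := 1)).ne, ← measureReal_def,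
      ← hω, ← ENNReal.ofReal_mul (by positivity)]
    congr 1
    rw [hρ, ← Real.rpow_natCast, ← Real.rpow_mul (by positivity), one_div, inv_mul_cancel₀ hn0, Real.rpow_one]
    field_simp
  -- lower bound
  have hlow : ∀ x ∈ {x | l < |g x|}, ENNReal.ofReal (μ * (l/2)^2) ≤
      ∫⁻ y in ball (0:EuclideanSpace ℝ (Fin n)) ρ, ENNReal.ofReal (|g (x+y) - g x|^2) := by
    intro x hx
    have hx' : l < |g x| := hx
    set S := {y | l/2 < |g (x+y)|} with hS
    have hSm : MeasurableSet S := by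
      apply measurableSet_lt measurable_const
      fun_prop
    have hSv : volume S = ENNReal.ofReal μ := by
      have : S = (fun y => x + y) ⁻¹' {x | l/2 < |g x|} := rfl
      rw [this, measure_preimage_add, hμ, measureReal_def, ENNReal.ofReal_toReal (hfin _ (by positivity))]
    have hdiff : ENNReal.ofReal μ ≤ volume (ball (0:EuclideanSpace ℝ (Fin n)) ρ \ S) := by
      calc ENNReal.ofReal μ = ENNReal.ofReal (2*μ) - ENNReal.ofReal μ := by
            rw [← ENNReal.ofReal_sub _ hμ0]; congr 1; ring
        _ = volume (ball (0:EuclideanSpace ℝ (Fin n)) ρ) - volume S := by rw [hball, hSv]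
        _ ≤ _ := le_measure_sdiff
    calc _ = ENNReal.ofReal ((l/2)^2) * ENNReal.ofReal μ := by
          rw [← ENNReal.ofReal_mul (by positivity)]; congr 1; ring
      _ ≤ ENNReal.ofReal ((l/2)^2) * volume (ball (0:EuclideanSpace ℝ (Fin n)) ρ \ S) := by gcongr
      _ = ∫⁻ y in (ball (0:EuclideanSpace ℝ (Fin n)) ρ \ S), ENNReal.ofReal ((l/2)^2) := by
          rw [setLIntegral_const]
      _ ≤ ∫⁻ y in (ball (0:EuclideanSpace ℝ (Fin n)) ρ \ S), ENNReal.ofReal (|g (x+y) - g x|^2) := by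
          refine setLIntegral_mono' (measurableSet_ball.diff hSm) fun y hyb => ?_
          have h1 : |g (x+y)| ≤ l/2 := not_lt.1 hyb.2
          have h2 : l/2 ≤ |g (x+y) - g x| := by
            have := abs_sub_abs_le_abs_sub (g x) (g (x+y))
            rw [abs_sub_comm] at this
            linarith
          gcongr
      _ ≤ _ := lintegral_mono_set Set.sdiff_subset
  -- upper bound
  have hm : Measurable (Function.uncurry fun (x y : EuclideanSpace ℝ (Fin n)) => ENNReal.ofReal (|g (x+y) - g x|^2)) := by
    unfold Function.uncurry
    fun_prop
  have hup : ∫⁻ x in {x | l < |g x|}, ∫⁻ y in ball (0:EuclideanSpace ℝ (Fin n)) ρ, ENNReal.ofReal (|g (x+y) - g x|^2)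
      ≤ ENNReal.ofReal (2*μ * (D * ρ^β)) := by
    rw [lintegral_lintegral_swap hm.aemeasurable]
    calc _ ≤ ∫⁻ y in ball (0:EuclideanSpace ℝ (Fin n)) ρ, ENNReal.ofReal (D * ρ^β) := by
          refine setLIntegral_mono' measurableSet_ball fun y hyb => ?_
          refine (setLIntegral_le_lintegral _ _).trans ((hy y).trans ?_)
          have : ‖y‖ ≤ ρ := by simpa using (mem_ball.1 hyb).le
          gcongr
      _ = _ := by
        rw [setLIntegral_const, hball, ← ENNReal.ofReal_mul (by positivity)]
        congr 1; ring
  have hEm : MeasurableSet {x | l < |g x|} := measurableSet_lt measurable_const hg.abs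
  have hcomb : ENNReal.ofReal (μ * (l/2)^2 * volume.real {x | l < |g x|}) ≤ ENNReal.ofReal (2*μ * (D * ρ^β)) := by
    refine le_trans ?_ hup
    refine le_trans ?_ (setLIntegral_mono' hEm hlow)
    rw [setLIntegral_const, ENNReal.ofReal_mul (by positivity), measureReal_def, ENNReal.ofReal_toReal (hfin _ hl)]
  rw [ENNReal.ofReal_le_ofReal_iff (by positivity)] at hcomb
  have hρβ : ρ^β = (2/ω)^(β/n) * μ^(β/n) := by
    rw [hρ, ← Real.rpow_mul (by positivity), ← Real.mul_rpow (by positivity) (by positivity)]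
    congr 1
    · ring
    · ring
  rw [hρβ] at hcomb
  have hl2 : l^(-2:ℝ) = (l^2)⁻¹ := by
    rw [Real.rpow_neg hl.le]; norm_cast
  rw [hl2]
  have : volume.real {x | l < |g x|} * l^2 ≤ 8 * (D * ((2/ω)^(β/n) * μ^(β/n))) := by
    have h3 : μ * (volume.real {x | l < |g x|} * l^2) ≤ μ * (8 * (D * ((2/ω)^(β/n) * μ^(β/n)))) := by
      linarith
    exact le_of_mul_le_mul_left h3 h0
  rw [← le_div_iff₀ (by positivity)] at this
  refine this.trans (le_of_eq ?_)
  ring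

lemma aesm_translate {n : ℕ} {F : Type*} [NormedAddCommGroup F] {g : EuclideanSpace ℝ (Fin n) → F}
    (hg : AEStronglyMeasurable g volume) (y : EuclideanSpace ℝ (Fin n)) :
    AEStronglyMeasurable (fun x => g (x + y)) volume :=
  hg.comp_measurePreserving (measurePreserving_add_right volume y)

lemma eLpNorm_translate {n : ℕ} {F : Type*} [NormedAddCommGroup F] {g : EuclideanSpace ℝ (Fin n) → F}
    (hg : AEStronglyMeasurable g volume) (p : ℝ≥0∞) (y : EuclideanSpace ℝ (Fin n)) :
    eLpNorm (fun x => g (x + y)) p volume = eLpNorm g p volume :=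
  eLpNorm_comp_measurePreserving hg (measurePreserving_add_right volume y)

lemma memLp_translate {n : ℕ} {F : Type*} [NormedAddCommGroup F] {g : EuclideanSpace ℝ (Fin n) → F} {p : ℝ≥0∞}
    (hg : MemLp g p volume) (y : EuclideanSpace ℝ (Fin n)) :
    MemLp (fun x => g (x + y)) p volume :=
  hg.comp_measurePreserving (measurePreserving_add_right volume y)

lemma diff_add_le {n : ℕ} {F : Type*} [NormedAddCommGroup F] {g : EuclideanSpace ℝ (Fin n) → F}
    (hg : AEStronglyMeasurable g volume) {p : ℝ≥0∞} (hp : 1 ≤ p) (y z : EuclideanSpace ℝ (Fin n)) :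
    eLpNorm (fun x => g (x + (y + z)) - g x) p volume ≤ eLpNorm (fun x => g (x + y) - g x) p volume
      + eLpNorm (fun x => g (x + z) - g x) p volume := by
  have e : (fun x => g (x + (y + z)) - g x) = (fun x => (fun x => g (x+y) - g x) (x+z)) + (fun x => g (x + z) - g x) := by
    ext x
    simp only [Pi.add_apply]
    rw [add_assoc x z y, add_comm z y]
    abel
  have h1 : AEStronglyMeasurable (fun x => g (x+y) - g x) volume := (aesm_translate hg y).sub hg
  rw [e]
  refine (eLpNorm_add_le (aesm_translate h1 z) ((aesm_translate hg z).sub hg) hp).trans ?_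
  rw [eLpNorm_translate h1]
  exact le_rfl

lemma diff_all {n : ℕ} {F : Type*} [NormedAddCommGroup F] {g : EuclideanSpace ℝ (Fin n) → F}
    (hg : AEStronglyMeasurable g volume) {p : ℝ≥0∞} (hp : 1 ≤ p) {C θ : ℝ} (hC : 0 ≤ C) (hθ : 0 ≤ θ)
    (h : ∀ (s : Fin n) (t : ℝ), eLpNorm (fun x => g (x + t • unitVec n s) - g x) p volume ≤ ENNReal.ofReal (C * |t|^θ))
    (y : EuclideanSpace ℝ (Fin n)) :
    eLpNorm (fun x => g (x + y) - g x) p volume ≤ ENNReal.ofReal (n * C * ‖y‖^θ) := by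
  have key : ∀ S : Finset (Fin n), eLpNorm (fun x => g (x + ∑ s ∈ S, y s • unitVec n s) - g x) p volume
      ≤ ∑ s ∈ S, ENNReal.ofReal (C * ‖y‖^θ) := by
    intro S
    induction S using Finset.induction_on with
    | empty => simp
    | insert a S ha ih =>
      rw [Finset.sum_insert ha, Finset.sum_insert ha]
      refine (diff_add_le hg hp _ _).trans (add_le_add ((h a (y a)).trans ?_) ih)
      have : |y a| ≤ ‖y‖ := by
        have := EuclideanSpace.norm_sq_eq y
        simpa using PiLp.norm_apply_le y a
      gcongr
  have hy : ∑ s, y s • unitVec n s = y := by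
    have := (EuclideanSpace.basisFun (Fin n) ℝ).sum_repr y
    simpa [unitVec] using this
  have := key Finset.univ
  rw [hy] at this
  refine this.trans (le_of_eq ?_)
  rw [Finset.sum_const, Finset.card_univ, Fintype.card_fin, nsmul_eq_mul, mul_assoc, ENNReal.ofReal_mul (p := (n:ℝ)) (by positivity)]
  simp

lemma embed_meas (n : ℕ) (hn : 1 ≤ n) {g : EuclideanSpace ℝ (Fin n) → ℝ} (hgm : Measurable g)
    (hg : MemLp g 2 volume) {C θ : ℝ} (hC : 0 ≤ C) (hθ : 0 < θ) (hθn : 2 * θ < n)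
    (h : ∀ (s : Fin n) (t : ℝ), eLpNorm (fun x => g (x + t • unitVec n s) - g x) 2 volume ≤ ENNReal.ofReal (C * |t|^θ))
    {r : ℝ} (hr : 0 < r) (hrn : r < 2 * n / (n - 2 * θ)) {B : Set (EuclideanSpace ℝ (Fin n))} (hB : volume B ≠ ⊤) :
    ∫⁻ x in B, ENNReal.ofReal (|g x|^r) < ⊤ := by
  have hsq : ∀ f : EuclideanSpace ℝ (Fin n) → ℝ, ∫⁻ x, ENNReal.ofReal (|f x|^2) = (eLpNorm f 2 volume)^2 := by
    intro f
    have := lintegral_eq_eLpNorm_pow (μ := volume) (f := f) (q := 2) (by norm_num)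
    have e2 : ENNReal.ofReal 2 = 2 := by simp
    rw [e2] at this
    rw [← ENNReal.rpow_two, ← this]
    congr 1; ext x
    rw [ENNReal.rpow_two, ENNReal.ofReal_pow (abs_nonneg _), ← Real.enorm_eq_ofReal_abs]
  set D := (n * C)^2 with hD
  have hy : ∀ y, ∫⁻ x, ENNReal.ofReal (|g (x+y) - g x|^2) ≤ ENNReal.ofReal (D * ‖y‖^(2*θ)) := by
    intro y
    rw [hsq]
    have := diff_all hg.1 (by norm_num) hC hθ.le h y
    calc _ ≤ (ENNReal.ofReal (n * C * ‖y‖^θ))^2 := by gcongr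
      _ = _ := by
        rw [← ENNReal.ofReal_pow (by positivity), hD, mul_pow, ← Real.rpow_natCast (‖y‖^θ), ← Real.rpow_mul (norm_nonneg _)]
        congr 3; push_cast; ring
  set N := (eLpNorm g 2 volume)^2 with hN
  have hNfin : N ≠ ⊤ := by
    rw [hN]; exact ENNReal.pow_ne_top hg.2.ne
  have hcheb : ∀ l : ℝ, 0 < l → volume {x | l < |g x|} ≤ N / ENNReal.ofReal (l^2) := by
    intro l hl
    rw [ENNReal.le_div_iff_mul_le (Or.inl (by simp; positivity)) (Or.inl (by simp)), mul_comm]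
    have := mul_meas_ge_le_lintegral₀ (μ := volume) (f := fun x => ENNReal.ofReal (|g x|^2)) (by fun_prop) (ENNReal.ofReal (l^2))
    rw [hsq, ← hN] at this
    refine le_trans ?_ this
    refine mul_le_mul_right (measure_mono ?_) _
    intro x
    exact fun hx => ENNReal.ofReal_le_ofReal (pow_le_pow_left₀ hl.le hx.le 2)
  have hfin : ∀ l : ℝ, 0 < l → volume {x | l < |g x|} ≠ ⊤ := by
    intro l hl
    refine ((hcheb l hl).trans_lt (ENNReal.div_lt_top hNfin (by simp; positivity))).ne
  set K0 := (8 * D * (2 / volume.real (ball (0:EuclideanSpace ℝ (Fin n)) 1))^(2*θ/n)) with hK0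
  have hK00 : 0 ≤ K0 := by
    have : 0 ≤ volume.real (ball (0:EuclideanSpace ℝ (Fin n)) 1) := measureReal_nonneg
    positivity
  have hn0 : (0:ℝ) < n := by positivity
  obtain ⟨e, he1, he2⟩ := exists_between hrn
  obtain ⟨C', hC', hdec⟩ := decay_iter (m := fun l => volume.real {x | l < |g x|}) (fun l => measureReal_nonneg)
    (K := max K0 N.toReal) (κ := 2*θ/n) (e := e) (le_max_of_le_left hK00) (by positivity) (by rw [div_lt_one hn0]; exact hθn)
    (by
      intro l hl
      have h1 := ENNReal.toReal_mono (ENNReal.div_lt_top hNfin (by simp; positivity)).ne (hcheb l hl)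
      rw [ENNReal.toReal_div, ENNReal.toReal_ofReal (by positivity)] at h1
      have hl2 : l^(-2:ℝ) = (l^2)⁻¹ := by
        rw [Real.rpow_neg hl.le]; norm_cast
      rw [hl2]
      refine h1.trans ?_
      rw [div_eq_mul_inv]
      gcongr
      exact le_max_right _ _)
    (by
      intro l hl
      refine (key_dist n hn hgm (by positivity) (by positivity) hy hl hfin).trans ?_
      gcongr
      exact le_max_left _ _)
    (by
      refine he2.trans_le (le_of_eq ?_)
      have : (n:ℝ) - 2 * θ ≠ 0 := by linarith
      field_simp)
  have : IsFiniteMeasure (volume.restrict B) := ⟨by simpa using hB.lt_top⟩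
  refine integ_of_decay hgm hr he1 hC' fun l hl => ?_
  refine (Measure.restrict_apply_le _ _).trans ?_
  have := hdec l hl
  rw [← ENNReal.ofReal_toReal (hfin l (by linarith))]
  exact ENNReal.ofReal_le_ofReal this

lemma embed (n : ℕ) (hn : 1 ≤ n) {g : EuclideanSpace ℝ (Fin n) → ℝ}
    (hg : MemLp g 2 volume) {C θ : ℝ} (hC : 0 ≤ C) (hθ : 0 < θ) (hθn : 2 * θ < n)
    (h : ∀ (s : Fin n) (t : ℝ), eLpNorm (fun x => g (x + t • unitVec n s) - g x) 2 volume ≤ ENNReal.ofReal (C * |t|^θ))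
    {r : ℝ} (hr : 0 < r) (hrn : r < 2 * n / (n - 2 * θ)) {B : Set (EuclideanSpace ℝ (Fin n))} (hB : volume B ≠ ⊤) :
    ∫⁻ x in B, ENNReal.ofReal (|g x|^r) < ⊤ := by
  have hae := hg.1.ae_eq_mk
  have hm := hg.1.stronglyMeasurable_mk
  have := embed_meas n hn (g := hg.1.mk g) hm.measurable (hg.ae_eq hae) hC hθ hθn (fun s t => by
    refine le_trans (le_of_eq (eLpNorm_congr_ae ?_)) (h s t)
    have h2 := (measurePreserving_add_right volume (t • unitVec n s)).quasiMeasurePreserving.ae_eq_comp hae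
    filter_upwards [hae, h2] with x hx hx2
    simp only [Function.comp] at hx2
    rw [hx, hx2]) hr hrn hB
  refine lt_of_le_of_lt (le_of_eq (lintegral_congr_ae ?_)) this
  filter_upwards [ae_restrict_of_ae hae] with x hx
  rw [hx]


lemma trans_cont {n : ℕ} {F : Type*} [NormedAddCommGroup F] {g : EuclideanSpace ℝ (Fin n) → F} {q : ℝ≥0∞}
    (hq1 : 1 ≤ q) (hq2 : q ≠ ⊤) (hg : MemLp g q volume) :
    Filter.Tendsto (fun z => eLpNorm (fun x => g (x - z) - g x) q volume) (nhds 0) (nhds 0) := by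
  have : Fact (1 ≤ q) := ⟨hq1⟩
  let G : EuclideanSpace ℝ (Fin n) → C(EuclideanSpace ℝ (Fin n), EuclideanSpace ℝ (Fin n)) :=
    fun z => (ContinuousMap.mk (fun a : EuclideanSpace ℝ (Fin n) × EuclideanSpace ℝ (Fin n) => a.2 - a.1) (by fun_prop)).curry z
  have hGc : Continuous G := (ContinuousMap.curry _).continuous
  have hGm : ∀ z, MeasurePreserving (G z) volume volume := fun z => measurePreserving_sub_right volume z
  have key := (continuous_const (y := hg.toLp g)).compMeasurePreservingLp hGc hGm hq2
  have h0 := key.tendsto 0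
  have h1 := tendsto_iff_edist_tendsto_0.1 h0
  refine h1.congr fun z => ?_
  rw [Lp.edist_def]
  apply eLpNorm_congr_ae
  have a1 := Lp.coeFn_compMeasurePreserving (hg.toLp g) (hGm z)
  have a2 := Lp.coeFn_compMeasurePreserving (hg.toLp g) (hGm 0)
  have a3 := hg.coeFn_toLp
  have a4 := (hGm z).quasiMeasurePreserving.ae_eq_comp a3
  have a5 := (hGm 0).quasiMeasurePreserving.ae_eq_comp a3
  filter_upwards [a1, a2, a4, a5] with x b1 b2 b4 b5
  rw [Pi.sub_apply, b1, b2, b4, b5]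
  simp [G]

lemma jensen_enn {X : Type*} [MeasurableSpace X] {μ : Measure X} [IsProbabilityMeasure μ] {f : X → ℝ≥0∞}
    (hf : AEMeasurable f μ) {q : ℝ} (hq : 1 < q) : (∫⁻ x, f x ∂μ)^q ≤ ∫⁻ x, (f x)^q ∂μ := by
  have := ENNReal.lintegral_mul_le_Lp_mul_Lq μ (Real.HolderConjugate.conjExponent hq) hf (g := fun _ => 1) aemeasurable_const
  simp only [Pi.mul_apply, mul_one, ENNReal.one_rpow, lintegral_const, measure_univ] at this
  calc _ ≤ ((∫⁻ a, f a ^ q ∂μ) ^ (1 / q))^q := by gcongr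
    _ = _ := by rw [← ENNReal.rpow_mul, one_div, inv_mul_cancel₀ (by linarith), ENNReal.rpow_one]

/-- mollification -/
noncomputable def moll {n : ℕ} {F : Type*} [NormedAddCommGroup F] [NormedSpace ℝ F]
    (φ : ContDiffBump (0 : EuclideanSpace ℝ (Fin n))) (g : EuclideanSpace ℝ (Fin n) → F) (x : EuclideanSpace ℝ (Fin n)) : F :=
  ∫ y, φ.normed volume y • g (x - y)

lemma moll_integrable {n : ℕ} {F : Type*} [NormedAddCommGroup F] [NormedSpace ℝ F]
    (φ : ContDiffBump (0 : EuclideanSpace ℝ (Fin n))) {g : EuclideanSpace ℝ (Fin n) → F}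
    (hg : LocallyIntegrable g volume) (x : EuclideanSpace ℝ (Fin n)) :
    Integrable (fun y => φ.normed volume y • g (x - y)) volume :=
  HasCompactSupport.convolutionExists_left (L := ContinuousLinearMap.lsmul ℝ ℝ) (μ := volume) φ.hasCompactSupport_normed φ.continuous_normed hg x

lemma moll_aux {n : ℕ} {F : Type*} [NormedAddCommGroup F] [NormedSpace ℝ F] [CompleteSpace F]
    (φ : ContDiffBump (0 : EuclideanSpace ℝ (Fin n))) {g : EuclideanSpace ℝ (Fin n) → F}
    (hgm : StronglyMeasurable g) (hg : LocallyIntegrable g volume) {q : ℝ} (hq : 1 < q) {ε : ℝ≥0∞}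
    (h : ∀ z ∈ ball (0:EuclideanSpace ℝ (Fin n)) φ.rOut, eLpNorm (fun x => g (x - z) - g x) (ENNReal.ofReal q) volume ≤ ε) :
    eLpNorm (fun x => moll φ g x - g x) (ENNReal.ofReal q) volume ≤ ε := by
  set ρ := φ.normed volume with hρ
  have hρm : Measurable (fun z => ENNReal.ofReal (ρ z)) := φ.continuous_normed.measurable.ennreal_ofReal
  set μ := volume.withDensity (fun z => ENNReal.ofReal (ρ z)) with hμ
  have hρ1 : ∫⁻ z, ENNReal.ofReal (ρ z) = 1 := by
    rw [← ofReal_integral_eq_lintegral_ofReal φ.integrable_normed (Filter.Eventually.of_forall φ.nonneg_normed), φ.integral_normed]; simp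
  have : IsProbabilityMeasure μ := ⟨by rw [hμ, withDensity_apply _ MeasurableSet.univ, setLIntegral_univ, hρ1]⟩
  have hjm : Measurable (Function.uncurry fun (x z : EuclideanSpace ℝ (Fin n)) => ‖g (x - z) - g x‖ₑ) := by
    unfold Function.uncurry
    have h1 : StronglyMeasurable (fun a : EuclideanSpace ℝ (Fin n) × EuclideanSpace ℝ (Fin n) => g (a.1 - a.2)) :=
      hgm.comp_measurable (by fun_prop)
    have h2 : StronglyMeasurable (fun a : EuclideanSpace ℝ (Fin n) × EuclideanSpace ℝ (Fin n) => g a.1) :=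
      hgm.comp_measurable (by fun_prop)
    exact (h1.sub h2).enorm
  have hpt : ∀ x, ‖moll φ g x - g x‖ₑ ≤ ∫⁻ z, ‖g (x - z) - g x‖ₑ ∂μ := by
    intro x
    have e : moll φ g x - g x = ∫ z, ρ z • (g (x - z) - g x) := by
      simp_rw [smul_sub]
      rw [integral_sub (moll_integrable φ hg x) (φ.integrable_normed.smul_const _), integral_smul_const, φ.integral_normed, one_smul]
      rfl
    have hjx : Measurable (fun z => ‖g (x - z) - g x‖ₑ) := hjm.comp measurable_prodMk_left
    rw [e, hμ, lintegral_withDensity_eq_lintegral_mul _ hρm hjx]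
    refine (enorm_integral_le_lintegral_enorm _).trans (le_of_eq ?_)
    congr 1; ext z
    rw [enorm_smul, Pi.mul_apply, Real.enorm_of_nonneg (φ.nonneg_normed z)]
  have hq0 : 0 < q := by linarith
  have hmain : ∫⁻ x, ‖moll φ g x - g x‖ₑ^q ≤ ε^q := by
    calc _ ≤ ∫⁻ x, ∫⁻ z, ‖g (x - z) - g x‖ₑ^q ∂μ := by
          refine lintegral_mono fun x => ?_
          refine le_trans (ENNReal.rpow_le_rpow (hpt x) hq0.le) ?_
          exact jensen_enn (hjm.comp measurable_prodMk_left).aemeasurable hq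
      _ = ∫⁻ z, (∫⁻ x, ‖g (x - z) - g x‖ₑ^q) ∂μ := by
          refine lintegral_lintegral_swap ?_
          exact (hjm.pow_const q).aemeasurable
      _ = ∫⁻ z, ENNReal.ofReal (ρ z) * ∫⁻ x, ‖g (x - z) - g x‖ₑ^q := by
          have hmm : Measurable (fun z => ∫⁻ x, ‖g (x - z) - g x‖ₑ^q) := by
            exact Measurable.lintegral_prod_left' (f := fun a : EuclideanSpace ℝ (Fin n) × EuclideanSpace ℝ (Fin n) => ‖g (a.1 - a.2) - g a.1‖ₑ^q) (hjm.pow_const q)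
          rw [hμ, lintegral_withDensity_eq_lintegral_mul _ hρm hmm]
          rfl
      _ ≤ ∫⁻ z, ENNReal.ofReal (ρ z) * ε^q := by
          refine lintegral_mono fun z => ?_
          by_cases hz : z ∈ ball (0:EuclideanSpace ℝ (Fin n)) φ.rOut
          · rw [lintegral_eq_eLpNorm_pow hq0]
            gcongr
            exact h z hz
          · have : ρ z = 0 := by
              rw [← Function.notMem_support, hρ, φ.support_normed_eq]; exact hz
            rw [this]; simp
      _ = _ := by rw [lintegral_mul_const _ hρm, hρ1, one_mul]
  rw [lintegral_eq_eLpNorm_pow hq0] at hmain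
  exact (ENNReal.rpow_le_rpow_iff hq0).1 hmain

lemma moll_Lq {n : ℕ} {F : Type*} [NormedAddCommGroup F] [NormedSpace ℝ F] [CompleteSpace F]
    (φ : ContDiffBump (0 : EuclideanSpace ℝ (Fin n))) {g : EuclideanSpace ℝ (Fin n) → F}
    {q : ℝ} (hq : 1 < q) (hg : MemLp g (ENNReal.ofReal q) volume) {ε : ℝ≥0∞}
    (h : ∀ z ∈ ball (0:EuclideanSpace ℝ (Fin n)) φ.rOut, eLpNorm (fun x => g (x - z) - g x) (ENNReal.ofReal q) volume ≤ ε) :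
    eLpNorm (fun x => moll φ g x - g x) (ENNReal.ofReal q) volume ≤ ε := by
  have hae := hg.1.ae_eq_mk
  have hg' := hg.ae_eq hae
  have h1q : 1 ≤ ENNReal.ofReal q := by simpa using hq.le
  have htr : ∀ z, (fun x => g (x - z)) =ᵐ[volume] (fun x => hg.1.mk g (x - z)) := fun z =>
    (measurePreserving_sub_right volume z).quasiMeasurePreserving.ae_eq_comp hae
  have htr2 : ∀ x, (fun z => g (x - z)) =ᵐ[volume] (fun z => hg.1.mk g (x - z)) := fun x =>
    (Measure.measurePreserving_sub_left volume x).quasiMeasurePreserving.ae_eq_comp hae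
  have := moll_aux φ hg.1.stronglyMeasurable_mk (hg'.locallyIntegrable h1q) hq (ε := ε) (fun z hz => by
    refine le_trans (le_of_eq (eLpNorm_congr_ae ?_)) (h z hz)
    filter_upwards [hae, htr z] with x b1 b2
    rw [b1, b2])
  refine le_trans (le_of_eq (eLpNorm_congr_ae ?_)) this
  filter_upwards [hae] with x hx
  rw [hx]
  congr 1
  unfold moll
  apply integral_congr_ae
  filter_upwards [htr2 x] with z hz
  rw [hz]

/-- global weak gradient -/
def WeakGrad (n : ℕ) (w : EuclideanSpace ℝ (Fin n) → ℝ) (Dw : EuclideanSpace ℝ (Fin n) → EuclideanSpace ℝ (Fin n)) : Prop :=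
  ∀ φ : EuclideanSpace ℝ (Fin n) → ℝ, ContDiff ℝ 1 φ → HasCompactSupport φ →
      ∫ x, w x • gradient φ x = -∫ x, φ x • Dw x

lemma hasGrad {n : ℕ} {φ : EuclideanSpace ℝ (Fin n) → ℝ} (h : ContDiff ℝ 1 φ) (x) : HasGradientAt φ (gradient φ x) x :=
  (h.differentiable one_ne_zero x).hasGradientAt

lemma grad_cont {n : ℕ} {φ : EuclideanSpace ℝ (Fin n) → ℝ} (h : ContDiff ℝ 1 φ) : Continuous (gradient φ) :=
  (LinearIsometryEquiv.continuous _).comp (h.continuous_fderiv one_ne_zero)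

lemma grad_supp {n : ℕ} {φ : EuclideanSpace ℝ (Fin n) → ℝ} {x} (hx : x ∉ tsupport φ) : gradient φ x = 0 := by
  have : φ =ᶠ[nhds x] fun _ => 0 := notMem_tsupport_iff_eventuallyEq.1 hx
  rw [gradient, this.fderiv_eq]; simp

lemma grad_hcs {n : ℕ} {φ : EuclideanSpace ℝ (Fin n) → ℝ} (h : HasCompactSupport φ) : HasCompactSupport (gradient φ) :=
  HasCompactSupport.intro h fun _ hx => grad_supp hx

lemma moll_contDiff {n : ℕ} (φ : ContDiffBump (0 : EuclideanSpace ℝ (Fin n))) {w : EuclideanSpace ℝ (Fin n) → ℝ}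
    (hw : LocallyIntegrable w volume) : ContDiff ℝ 1 (moll φ w) :=
  HasCompactSupport.contDiff_convolution_left (n := 1) (ContinuousLinearMap.lsmul ℝ ℝ) φ.hasCompactSupport_normed φ.contDiff_normed hw

lemma moll_grad {n : ℕ} (φ : ContDiffBump (0 : EuclideanSpace ℝ (Fin n))) {w : EuclideanSpace ℝ (Fin n) → ℝ}
    {Dw : EuclideanSpace ℝ (Fin n) → EuclideanSpace ℝ (Fin n)}
    (hw : LocallyIntegrable w volume) (hDw : LocallyIntegrable Dw volume) (hW : WeakGrad n w Dw) (x) :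
    gradient (moll φ w) x = moll φ Dw x := by
  set ρ := φ.normed volume with hρ
  have hρc : ContDiff ℝ 1 ρ := φ.contDiff_normed
  have hρs : HasCompactSupport ρ := φ.hasCompactSupport_normed
  have e : moll φ w = convolution w ρ (ContinuousLinearMap.mul ℝ ℝ) volume := by
    ext x
    unfold moll convolution
    rw [← integral_sub_left_eq_self _ volume x]
    congr 1; ext y
    simp [mul_comm, ← hρ]
  have hd := hρs.hasFDerivAt_convolution_right (ContinuousLinearMap.mul ℝ ℝ) hw hρc x
  rw [← e] at hd
  rw [gradient, hd.fderiv]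
  rw [LinearIsometryEquiv.symm_apply_eq]
  -- the test function
  set ψ : EuclideanSpace ℝ (Fin n) → ℝ := fun y => ρ (x - y) with hψ
  have hψc : ContDiff ℝ 1 ψ := hρc.comp (by fun_prop)
  have hψs : HasCompactSupport ψ := hρs.comp_homeomorph (Homeomorph.subLeft x)
  have hgψ : ∀ y, gradient ψ y = - gradient ρ (x - y) := by
    intro y
    have h1 : HasFDerivAt ρ (fderiv ℝ ρ (x-y)) (x - y) := (hρc.differentiable one_ne_zero _).hasFDerivAt
    have h2 : HasFDerivAt (fun y => x - y) (-ContinuousLinearMap.id ℝ (EuclideanSpace ℝ (Fin n))) y := by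
      simpa using (hasFDerivAt_id y).const_sub x
    have h3 := h1.comp y h2
    have h4 : fderiv ℝ ψ y = -fderiv ℝ ρ (x-y) := by
      rw [show ψ = ρ ∘ (fun y => x - y) from rfl, h3.fderiv]; ext v; simp
    rw [gradient, gradient, h4, map_neg]
  have hInt1 : Integrable (fun y => w y • gradient ψ y) volume := by
    have := hw.integrable_smul_right_of_hasCompactSupport (grad_cont hψc) (grad_hcs hψs)
    exact this
  have hInt2 : Integrable (fun y => ψ y • Dw y) volume :=
    hDw.integrable_smul_left_of_hasCompactSupport hψc.continuous hψs
  have hM : moll φ Dw x = ∫ y, ψ y • Dw y := by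
    unfold moll
    rw [← integral_sub_left_eq_self _ volume x]
    congr 1; ext y
    simp [← hρ, hψ]
  ext v
  rw [convolution_precompR_apply (ContinuousLinearMap.mul ℝ ℝ) hw (hρs.fderiv ℝ) (hρc.continuous_fderiv one_ne_zero)]
  rw [InnerProductSpace.toDual_apply_apply, hM, ← neg_neg (∫ y, ψ y • Dw y), ← hW ψ hψc hψs, inner_neg_left, real_inner_comm,
    ← integral_inner hInt1 v]
  unfold convolution
  rw [← integral_neg]
  congr 1; ext y
  rw [real_inner_comm, inner_smul_left, hgψ, inner_neg_left, gradient]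
  simp [InnerProductSpace.toDual_symm_apply]

lemma bump_seq (n : ℕ) (k : ℕ) : ∃ φ : ContDiffBump (0 : EuclideanSpace ℝ (Fin n)), φ.rOut = 1/((k:ℝ)+1) :=
  ⟨⟨1/((k:ℝ)+1)/2, 1/((k:ℝ)+1), by positivity, by
    have : 0 < 1/((k:ℝ)+1) := by positivity
    linarith⟩, rfl⟩

lemma moll_tendsto {n : ℕ} {F : Type*} [NormedAddCommGroup F] [NormedSpace ℝ F] [CompleteSpace F]
    {φ : ℕ → ContDiffBump (0 : EuclideanSpace ℝ (Fin n))} (hφ : ∀ k : ℕ, (φ k).rOut = 1/((k:ℝ)+1))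
    {g : EuclideanSpace ℝ (Fin n) → F}
    {q : ℝ} (hq : 1 < q) (hg : MemLp g (ENNReal.ofReal q) volume) :
    Filter.Tendsto (fun k => eLpNorm (fun x => moll (φ k) g x - g x) (ENNReal.ofReal q) volume) Filter.atTop (nhds 0) := by
  have htc := trans_cont (by simpa using hq.le) (by simp) hg
  rw [ENNReal.tendsto_nhds_zero] at htc ⊢
  intro ε hε
  have := htc ε hε
  rw [Metric.eventually_nhds_iff_ball] at this
  obtain ⟨δ, hδ, h⟩ := this
  have hl := tendsto_one_div_add_atTop_nhds_zero_nat (𝕜 := ℝ)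
  filter_upwards [hl.eventually (gt_mem_nhds hδ)] with k hk
  refine moll_Lq (φ k) hq hg fun z hz => h z ?_
  rw [hφ k] at hz
  exact ball_subset_ball hk.le hz

/-- Approximation -/
lemma approx {n : ℕ} {w : EuclideanSpace ℝ (Fin n) → ℝ}
    {Dw : EuclideanSpace ℝ (Fin n) → EuclideanSpace ℝ (Fin n)} {q : ℝ} (hq : 1 < q)
    (hw : MemLp w (ENNReal.ofReal q) volume) (hDw : MemLp Dw (ENNReal.ofReal q) volume) (hW : WeakGrad n w Dw) :
    ∃ W : ℕ → EuclideanSpace ℝ (Fin n) → ℝ, (∀ k, ContDiff ℝ 1 (W k)) ∧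
      (∀ k, MemLp (W k) (ENNReal.ofReal q) volume) ∧ (∀ k, MemLp (gradient (W k)) (ENNReal.ofReal q) volume) ∧
      Filter.Tendsto (fun k => eLpNorm (fun x => W k x - w x) (ENNReal.ofReal q) volume) Filter.atTop (nhds 0) ∧
      Filter.Tendsto (fun k => eLpNorm (fun x => gradient (W k) x - Dw x) (ENNReal.ofReal q) volume) Filter.atTop (nhds 0) := by
  choose φ hφ using bump_seq n
  have h1q : 1 ≤ ENNReal.ofReal q := by simpa using hq.le
  have hwl := hw.locallyIntegrable h1q
  have hDl := hDw.locallyIntegrable h1q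
  have hg : ∀ k x, gradient (moll (φ k) w) x = moll (φ k) Dw x := fun k x => moll_grad (φ k) hwl hDl hW x
  have t1 := moll_tendsto hφ hq hw
  have t2 := moll_tendsto hφ hq hDw
  have hc : ∀ k, ContDiff ℝ 1 (moll (φ k) w) := fun k => moll_contDiff (φ k) hwl
  have ev : ∀ᶠ k in Filter.atTop, eLpNorm (fun x => moll (φ k) w x - w x) (ENNReal.ofReal q) volume < ⊤ ∧
    eLpNorm (fun x => moll (φ k) Dw x - Dw x) (ENNReal.ofReal q) volume < ⊤ :=
    (t1.eventually (gt_mem_nhds ENNReal.zero_lt_top)).and (t2.eventually (gt_mem_nhds ENNReal.zero_lt_top))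
  obtain ⟨N, hN⟩ := Filter.eventually_atTop.1 ev
  refine ⟨fun k => moll (φ (k+N)) w, fun k => hc _, fun k => ?_, fun k => ?_, 
    t1.comp (Filter.tendsto_add_atTop_nat N), ?_⟩
  · have h := (hN (k+N) (by omega)).1
    have : MemLp (fun x => moll (φ (k+N)) w x - w x) (ENNReal.ofReal q) volume :=
      ⟨(hc _).continuous.aestronglyMeasurable.sub hw.1, h⟩
    have := this.add hw
    convert this using 1
    ext x; simp
  · have h := (hN (k+N) (by omega)).2
    simp_rw [← hg] at h
    have : MemLp (fun x => gradient (moll (φ (k+N)) w) x - Dw x) (ENNReal.ofReal q) volume :=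
      ⟨(grad_cont (hc _)).aestronglyMeasurable.sub hDw.1, h⟩
    have := this.add hDw
    convert this using 1
    ext x; simp
  · simp_rw [hg]
    exact t2.comp (Filter.tendsto_add_atTop_nat N)


lemma pair_bound {X F : Type*} [MeasurableSpace X] {μ : Measure X} [NormedAddCommGroup F] [InnerProductSpace ℝ F]
    {p q : ℝ} (hpq : p.HolderConjugate q) {A B : X → F}
    (hA : MemLp A (ENNReal.ofReal p) μ) (hB : MemLp B (ENNReal.ofReal q) μ) :
    Integrable (fun x => ⟪A x, B x⟫) μ ∧
      eLpNorm (fun x => ⟪A x, B x⟫) 1 μ ≤ eLpNorm A (ENNReal.ofReal p) μ * eLpNorm B (ENNReal.ofReal q) μ := by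
  have : ENNReal.HolderTriple (ENNReal.ofReal p) (ENNReal.ofReal q) 1 := hpq.ennrealOfReal
  have h1 : ∀ᵐ x ∂μ, ‖(fun a b : F => (⟪a, b⟫ : ℝ)) (A x) (B x)‖₊ ≤ (1:NNReal) * ‖A x‖₊ * ‖B x‖₊ := by
    refine Filter.Eventually.of_forall fun x => ?_
    rw [one_mul]
    exact nnnorm_inner_le_nnnorm _ _
  constructor
  · rw [← memLp_one_iff_integrable]
    exact MemLp.of_bilin (fun a b : F => (⟪a, b⟫ : ℝ)) 1 hA hB (hA.1.inner hB.1) h1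
  · have := eLpNorm_le_eLpNorm_mul_eLpNorm_of_nnnorm hA.1 hB.1 (fun a b : F => (⟪a, b⟫ : ℝ)) 1 h1 (r := 1)
      (p := ENNReal.ofReal p) (q := ENNReal.ofReal q)
    simpa using this

lemma pair_limit {X F : Type*} [MeasurableSpace X] {μ : Measure X} [NormedAddCommGroup F] [InnerProductSpace ℝ F]
    {p q : ℝ} (hpq : p.HolderConjugate q) {A B : X → F} {Bk : ℕ → X → F}
    (hA : MemLp A (ENNReal.ofReal p) μ) (hB : MemLp B (ENNReal.ofReal q) μ) (hBk : ∀ k, MemLp (Bk k) (ENNReal.ofReal q) μ)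
    (hl : Filter.Tendsto (fun k => eLpNorm (fun x => Bk k x - B x) (ENNReal.ofReal q) μ) Filter.atTop (nhds 0)) :
    Filter.Tendsto (fun k => ∫ x, ⟪A x, Bk k x⟫ ∂μ) Filter.atTop (nhds (∫ x, ⟪A x, B x⟫ ∂μ)) := by
  rw [tendsto_iff_edist_tendsto_0]
  have h2 : Filter.Tendsto (fun k => eLpNorm A (ENNReal.ofReal p) μ * eLpNorm (fun x => Bk k x - B x) (ENNReal.ofReal q) μ)
      Filter.atTop (nhds 0) := by
    simpa using ENNReal.Tendsto.const_mul hl (Or.inr hA.2.ne)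
  refine tendsto_of_tendsto_of_tendsto_of_le_of_le tendsto_const_nhds h2 (fun _ => zero_le) fun k => ?_
  simp only
  rw [edist_eq_enorm_sub, ← integral_sub (pair_bound hpq hA (hBk k)).1 (pair_bound hpq hA hB).1]
  simp_rw [← inner_sub_right]
  refine (enorm_integral_le_lintegral_enorm _).trans ?_
  rw [← eLpNorm_one_eq_lintegral_enorm]
  exact (pair_bound hpq hA ((hBk k).sub hB)).2

lemma dq_smooth {n : ℕ} {W : EuclideanSpace ℝ (Fin n) → ℝ} {q : ℝ} (hq : 1 < q) (hW : ContDiff ℝ 1 W)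
    (h : EuclideanSpace ℝ (Fin n)) :
    eLpNorm (fun x => W (x + h) - W x) (ENNReal.ofReal q) volume ≤ ‖h‖ₑ * eLpNorm (gradient W) (ENNReal.ofReal q) volume := by
  set μ : Measure ℝ := volume.restrict (Set.Ioc 0 1)
  have : IsProbabilityMeasure μ := ⟨by simp [μ]⟩
  have hgc := grad_cont hW
  have hq0 : 0 < q := by linarith
  have hc : Continuous (fun a : EuclideanSpace ℝ (Fin n) × ℝ => ‖h‖ₑ * ‖gradient W (a.1 + a.2 • h)‖ₑ) := by
    have : Continuous (fun a : EuclideanSpace ℝ (Fin n) × ℝ => gradient W (a.1 + a.2 • h)) := by fun_prop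
    exact (ENNReal.continuous_const_mul (by simp)).comp this.enorm
  have hpt : ∀ x, ‖W (x+h) - W x‖ₑ ≤ ∫⁻ t, ‖h‖ₑ * ‖gradient W (x + t • h)‖ₑ ∂μ := by
    intro x
    have hd : ∀ t : ℝ, HasDerivAt (fun t : ℝ => W (x + t • h)) (⟪gradient W (x + t • h), h⟫) t := by
      intro t
      have h1 : HasFDerivAt W _ (x + t • h) := (hasGrad hW (x + t • h)).hasFDerivAt
      have h2 : HasDerivAt (fun t : ℝ => x + t • h) h t := by
        simpa using ((hasDerivAt_id t).smul_const h).const_add x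
      have h3 := h1.comp_hasDerivAt t h2
      have e : (⟪gradient W (x + t • h), h⟫ : ℝ) = (InnerProductSpace.toDual ℝ _ (gradient W (x + t • h))) h := by
        rw [InnerProductSpace.toDual_apply_apply]
      rw [e]
      exact h3
    have hcc : Continuous (fun t : ℝ => (⟪gradient W (x + t • h), h⟫ : ℝ)) := by fun_prop
    have := intervalIntegral.integral_eq_sub_of_hasDerivAt (a := 0) (b := 1) (fun t _ => hd t) (hcc.intervalIntegrable _ _)
    simp only [one_smul, zero_smul, add_zero] at this
    rw [← this, intervalIntegral.integral_of_le zero_le_one]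
    refine (enorm_integral_le_lintegral_enorm _).trans ?_
    refine lintegral_mono fun t => ?_
    rw [mul_comm]
    simp only [enorm]
    exact_mod_cast nnnorm_inner_le_nnnorm (𝕜 := ℝ) (gradient W (x + t • h)) h
  have hmain : ∫⁻ x, ‖W (x+h) - W x‖ₑ^q ≤ (‖h‖ₑ * eLpNorm (gradient W) (ENNReal.ofReal q) volume)^q := by
    calc _ ≤ ∫⁻ x, ∫⁻ t, (‖h‖ₑ * ‖gradient W (x + t • h)‖ₑ)^q ∂μ := by
          refine lintegral_mono fun x => ?_
          refine le_trans (ENNReal.rpow_le_rpow (hpt x) hq0.le) ?_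
          exact jensen_enn (hc.comp (Continuous.prodMk_right x)).measurable.aemeasurable hq
      _ = ∫⁻ t, (∫⁻ x, (‖h‖ₑ * ‖gradient W (x + t • h)‖ₑ)^q) ∂μ := by
          refine lintegral_lintegral_swap ?_
          exact (hc.measurable.pow_const q).aemeasurable
      _ = ∫⁻ t, (‖h‖ₑ * eLpNorm (gradient W) (ENNReal.ofReal q) volume)^q ∂μ := by
          congr 1; ext t
          simp_rw [ENNReal.mul_rpow_of_nonneg _ _ hq0.le]
          rw [lintegral_const_mul, lintegral_eq_eLpNorm_pow hq0 (f := fun x => gradient W (x + t • h)), eLpNorm_translate hgc.aestronglyMeasurable]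
          have : Continuous (fun x => gradient W (x + t • h)) := by fun_prop
          exact this.enorm.measurable.pow_const q
      _ = _ := by simp
  rw [lintegral_eq_eLpNorm_pow hq0 (f := fun x => W (x+h) - W x)] at hmain
  exact (ENNReal.rpow_le_rpow_iff hq0).1 hmain

lemma eLpNorm_tendsto_of_sub {X F : Type*} [MeasurableSpace X] {μ : Measure X} [NormedAddCommGroup F]
    {q : ℝ≥0∞} (hq : 1 ≤ q) {B : X → F} {Bk : ℕ → X → F}
    (hB : AEStronglyMeasurable B μ) (hBk : ∀ k, AEStronglyMeasurable (Bk k) μ) {c : ℝ≥0∞} {ck : ℕ → ℝ≥0∞}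
    (hl : Filter.Tendsto (fun k => eLpNorm (fun x => Bk k x - B x) q μ) Filter.atTop (nhds 0))
    (hck : ∀ k, eLpNorm (Bk k) q μ ≤ ck k) (hc : Filter.Tendsto ck Filter.atTop (nhds c)) :
    eLpNorm B q μ ≤ c := by
  have h1 : ∀ k, eLpNorm B q μ ≤ ck k + eLpNorm (fun x => Bk k x - B x) q μ := by
    intro k
    have e : B = fun x => Bk k x - (Bk k x - B x) := by ext x; simp
    calc eLpNorm B q μ = eLpNorm (fun x => Bk k x - (Bk k x - B x)) q μ := by rw [← e]
      _ ≤ eLpNorm (Bk k) q μ + eLpNorm (fun x => Bk k x - B x) q μ := eLpNorm_sub_le (hBk k) ((hBk k).sub hB) hq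
      _ ≤ _ := by gcongr; exact hck k
  have h2 := hc.add hl
  rw [add_zero] at h2
  exact ge_of_tendsto' h2 h1

lemma tau_tendsto {n : ℕ} {F : Type*} [NormedAddCommGroup F] {q : ℝ≥0∞} (hq : 1 ≤ q)
    {B : EuclideanSpace ℝ (Fin n) → F} {Bk : ℕ → EuclideanSpace ℝ (Fin n) → F}
    (hB : AEStronglyMeasurable B volume) (hBk : ∀ k, AEStronglyMeasurable (Bk k) volume)
    (hl : Filter.Tendsto (fun k => eLpNorm (fun x => Bk k x - B x) q volume) Filter.atTop (nhds 0))
    (h : EuclideanSpace ℝ (Fin n)) :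
    Filter.Tendsto (fun k => eLpNorm (fun x => (Bk k (x+h) - Bk k x) - (B (x+h) - B x)) q volume) Filter.atTop (nhds 0) := by
  have h2 := hl.add hl
  rw [add_zero] at h2
  refine tendsto_of_tendsto_of_tendsto_of_le_of_le tendsto_const_nhds h2 (fun _ => zero_le) fun k => ?_
  have e : (fun x => (Bk k (x+h) - Bk k x) - (B (x+h) - B x)) = fun x => (fun y => Bk k y - B y) (x+h) - (fun y => Bk k y - B y) x := by
    ext x; simp only; abel
  simp only
  rw [e]
  have hm : AEStronglyMeasurable (fun y => Bk k y - B y) volume := (hBk k).sub hB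
  refine (eLpNorm_sub_le (aesm_translate hm h) hm hq).trans ?_
  rw [eLpNorm_translate hm]

lemma diff_quot {n : ℕ} {w : EuclideanSpace ℝ (Fin n) → ℝ}
    {Dw : EuclideanSpace ℝ (Fin n) → EuclideanSpace ℝ (Fin n)} {q : ℝ} (hq : 1 < q)
    (hw : MemLp w (ENNReal.ofReal q) volume) (hDw : MemLp Dw (ENNReal.ofReal q) volume) (hW : WeakGrad n w Dw)
    (h : EuclideanSpace ℝ (Fin n)) :
    eLpNorm (fun x => w (x + h) - w x) (ENNReal.ofReal q) volume ≤ ‖h‖ₑ * eLpNorm Dw (ENNReal.ofReal q) volume := by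
  obtain ⟨W, hc, h1, h2, t1, t2⟩ := approx hq hw hDw hW
  have h1q : 1 ≤ ENNReal.ofReal q := by simpa using hq.le
  have t3 : Filter.Tendsto (fun k => ‖h‖ₑ * (eLpNorm Dw (ENNReal.ofReal q) volume +
      eLpNorm (fun x => gradient (W k) x - Dw x) (ENNReal.ofReal q) volume)) Filter.atTop
      (nhds (‖h‖ₑ * (eLpNorm Dw (ENNReal.ofReal q) volume + 0))) :=
    ENNReal.Tendsto.const_mul (tendsto_const_nhds.add t2) (Or.inr (by simp))
  rw [add_zero] at t3
  refine eLpNorm_tendsto_of_sub h1q ((aesm_translate hw.1 h).sub hw.1)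
    (Bk := fun k x => W k (x+h) - W k x) (fun k => (aesm_translate (h1 k).1 h).sub (h1 k).1)
    (tau_tendsto h1q hw.1 (fun k => (h1 k).1) t1 h) (fun k => ?_) t3
  refine (dq_smooth hq (hc k) h).trans ?_
  gcongr
  have e : gradient (W k) = fun x => Dw x + (gradient (W k) x - Dw x) := by ext x; simp
  calc _ = eLpNorm (fun x => Dw x + (gradient (W k) x - Dw x)) (ENNReal.ofReal q) volume := by rw [← e]
    _ ≤ _ := eLpNorm_add_le hDw.1 ((h2 k).1.sub hDw.1) h1q


lemma grad_mul {n : ℕ} {a b : EuclideanSpace ℝ (Fin n) → ℝ} (ha : ContDiff ℝ 1 a) (hb : ContDiff ℝ 1 b) (x) :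
    gradient (fun y => a y * b y) x = a x • gradient b x + b x • gradient a x := by
  unfold gradient
  rw [fderiv_fun_mul (ha.differentiable one_ne_zero x) (hb.differentiable one_ne_zero x), map_add, map_smul, map_smul]

lemma grad_sub {n : ℕ} {a b : EuclideanSpace ℝ (Fin n) → ℝ} (ha : ContDiff ℝ 1 a) (hb : ContDiff ℝ 1 b) (x) :
    gradient (fun y => a y - b y) x = gradient a x - gradient b x := by
  unfold gradient
  rw [fderiv_fun_sub (ha.differentiable one_ne_zero x) (hb.differentiable one_ne_zero x), map_sub]

lemma grad_shift {n : ℕ} {a : EuclideanSpace ℝ (Fin n) → ℝ} (h x) :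
    gradient (fun y => a (y + h)) x = gradient a (x + h) := by
  unfold gradient
  rw [fderiv_comp_add_right]

lemma shift_contDiff {n : ℕ} {a : EuclideanSpace ℝ (Fin n) → ℝ} (ha : ContDiff ℝ 1 a) (h) :
    ContDiff ℝ 1 (fun y => a (y + h)) := ha.comp (by fun_prop)

lemma memLp_smul_bdd {X F : Type*} [MeasurableSpace X] {μ : Measure X} [NormedAddCommGroup F] [NormedSpace ℝ F]
    {p : ℝ≥0∞} {A : X → F} {ζ : X → ℝ} (hA : MemLp A p μ) (hζ : AEStronglyMeasurable ζ μ) {M : ℝ} (hM : ∀ x, ‖ζ x‖ ≤ M) :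
    MemLp (fun x => ζ x • A x) p μ := by
  refine MemLp.of_le_mul (c := M) hA (hζ.smul hA.1) (Filter.Eventually.of_forall fun x => ?_)
  rw [norm_smul]
  gcongr
  exact hM x

lemma memLp_inner_bdd {X F : Type*} [MeasurableSpace X] {μ : Measure X} [NormedAddCommGroup F] [InnerProductSpace ℝ F]
    {p : ℝ≥0∞} {A : X → F} {Z : X → F} (hA : MemLp A p μ) (hζ : AEStronglyMeasurable Z μ) {M : ℝ} (hM : ∀ x, ‖Z x‖ ≤ M) :
    MemLp (fun x => (⟪A x, Z x⟫ : ℝ)) p μ := by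
  refine MemLp.of_le_mul (c := M) hA (hA.1.inner hζ) (Filter.Eventually.of_forall fun x => ?_)
  refine (norm_inner_le_norm _ _).trans ?_
  rw [mul_comm]
  gcongr
  exact hM x

lemma Hmap_memLp {n : ℕ} {q p : ℝ} (hq1 : 1 < q) (hp : p = q/(q-1)) {X : Type*} [MeasurableSpace X] {μ : Measure X}
    {D : X → EuclideanSpace ℝ (Fin n)} (hD : MemLp D (ENNReal.ofReal q) μ) :
    MemLp (fun x => Hmap n (q-1) (D x)) (ENNReal.ofReal p) μ := by
  have h := hD.norm_rpow_div (ENNReal.ofReal (q-1))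
  rw [← ENNReal.ofReal_div_of_pos (by linarith), ← hp, ENNReal.toReal_ofReal (by linarith)] at h
  refine h.mono ((Hmap_meas n (q-1)).comp_aemeasurable hD.1.aemeasurable).aestronglyMeasurable (Filter.Eventually.of_forall fun x => ?_)
  rw [Real.norm_of_nonneg (by positivity)]
  exact Hmap_norm_le n (by linarith) _

lemma vmap_memLp {n : ℕ} {q : ℝ} (hq1 : 1 < q) {X : Type*} [MeasurableSpace X] {μ : Measure X}
    {D : X → EuclideanSpace ℝ (Fin n)} (hD : MemLp D (ENNReal.ofReal q) μ) :
    MemLp (fun x => vmap n q (D x)) 2 μ := by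
  have h := hD.norm_rpow_div (ENNReal.ofReal (q/2))
  rw [← ENNReal.ofReal_div_of_pos (by linarith), show q/(q/2) = 2 by field_simp, ENNReal.toReal_ofReal (by linarith), ENNReal.ofReal_ofNat] at h
  refine h.mono ((vmap_meas n q).comp_aemeasurable hD.1.aemeasurable).aestronglyMeasurable (Filter.Eventually.of_forall fun x => ?_)
  rw [Real.norm_of_nonneg (vmap_nonneg _ _ _), Real.norm_of_nonneg (by positivity)]
  exact vmap_le n (by linarith) _

/-- tested identity for a smooth function W -/
lemma energy_smooth {n : ℕ} {p q : ℝ} (hpq : p.HolderConjugate q)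
    {G : EuclideanSpace ℝ (Fin n) → EuclideanSpace ℝ (Fin n)} {F : EuclideanSpace ℝ (Fin n) → ℝ}
    (hG : MemLp G (ENNReal.ofReal p) volume) (hF : MemLp F (ENNReal.ofReal p) volume)
    {x0 : EuclideanSpace ℝ (Fin n)} {R : ℝ} (hR : 0 < R)
    (heq : ∀ φ : EuclideanSpace ℝ (Fin n) → ℝ, ContDiff ℝ 1 φ → HasCompactSupport φ → tsupport φ ⊆ ball x0 (4*R) →
      ∫ x, ⟪G x, gradient φ x⟫ = ∫ x, F x * φ x)
    {ζ : EuclideanSpace ℝ (Fin n) → ℝ} (hζ : ContDiff ℝ 1 ζ) (hζs : tsupport ζ ⊆ closedBall x0 (2*R))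
    {W : EuclideanSpace ℝ (Fin n) → ℝ} (hW : ContDiff ℝ 1 W) {h : EuclideanSpace ℝ (Fin n)} (hh : ‖h‖ ≤ R) :
    ∫ x, ⟪G (x+h) - G x, (W (x+h) - W x) • gradient ζ x + ζ x • (gradient W (x+h) - gradient W x)⟫
      = ∫ x, (F (x+h) - F x) * (ζ x * (W (x+h) - W x)) := by
  set ψ : EuclideanSpace ℝ (Fin n) → ℝ := fun x => ζ x * (W (x+h) - W x) with hψ
  have hWh := shift_contDiff hW h
  have hψc : ContDiff ℝ 1 ψ := hζ.mul (hWh.sub hW)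
  have hζcs : HasCompactSupport ζ := (isCompact_closedBall x0 (2*R)).of_isClosed_subset (isClosed_tsupport _) hζs
  have hψcs : HasCompactSupport ψ := hζcs.mul_right
  have hψs : tsupport ψ ⊆ closedBall x0 (2*R) := (tsupport_mul_subset_left).trans hζs
  have hgψ : ∀ x, gradient ψ x = (W (x+h) - W x) • gradient ζ x + ζ x • (gradient W (x+h) - gradient W x) := by
    intro x
    rw [hψ, grad_mul hζ (hWh.sub hW), grad_sub hWh hW, grad_shift, add_comm]
  simp_rw [← hgψ]
  set φ : EuclideanSpace ℝ (Fin n) → ℝ := fun x => ψ (x + -h) - ψ x with hφ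
  have hφc : ContDiff ℝ 1 φ := (shift_contDiff hψc (-h)).sub hψc
  have hsupp : tsupport φ ⊆ closedBall x0 (3*R) := by
    refine closure_minimal (fun x hx => ?_) isClosed_closedBall
    by_contra hx3
    rw [mem_closedBall, not_le] at hx3
    apply hx
    have z1 : ψ x = 0 := by
      apply image_eq_zero_of_notMem_tsupport
      intro hc
      have := hψs hc
      rw [mem_closedBall] at this
      linarith
    have z2 : ψ (x + -h) = 0 := by
      apply image_eq_zero_of_notMem_tsupport
      intro hc
      have := hψs hc
      rw [mem_closedBall] at this
      have h2 : dist x (x + -h) = ‖h‖ := by simp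
      have := dist_triangle x (x + -h) x0
      linarith
    simp [hφ, z1, z2]
  have hφcs : HasCompactSupport φ := (isCompact_closedBall x0 (3*R)).of_isClosed_subset (isClosed_tsupport _) hsupp
  have key := heq φ hφc hφcs (hsupp.trans (closedBall_subset_ball (by linarith)))
  have hgφ : ∀ x, gradient φ x = gradient ψ (x + -h) - gradient ψ x := by
    intro x
    rw [hφ, grad_sub (shift_contDiff hψc (-h)) hψc, grad_shift]
  have hgψL : MemLp (gradient ψ) (ENNReal.ofReal q) volume := (grad_cont hψc).memLp_of_hasCompactSupport (grad_hcs hψcs)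
  have hψL : MemLp ψ (ENNReal.ofReal q) volume := hψc.continuous.memLp_of_hasCompactSupport hψcs
  have i1 := (pair_bound hpq hG hgψL).1
  have i2 := (pair_bound hpq hG (memLp_translate hgψL (-h))).1
  have i3 := (pair_bound hpq (memLp_translate hG h) hgψL).1
  have j1 := (pair_bound hpq hF hψL).1
  have j2 := (pair_bound hpq hF (memLp_translate hψL (-h))).1
  have j3 := (pair_bound hpq (memLp_translate hF h) hψL).1
  have m : ∀ a b : ℝ, ⟪a, b⟫ = a * b := fun a b => by rw [real_inner_eq_re_inner]; simp [mul_comm]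
  simp only [m] at j1 j2 j3
  simp_rw [hgφ, inner_sub_right] at key
  rw [integral_sub i2 i1] at key
  simp only [hφ, mul_sub] at key
  rw [integral_sub j2 j1] at key
  simp_rw [inner_sub_left, sub_mul]
  rw [integral_sub i3 i1, integral_sub j3 j1]
  have s1 := integral_add_right_eq_self (μ := volume) (fun x => (⟪G x, gradient ψ (x + -h)⟫ : ℝ)) h
  have s2 := integral_add_right_eq_self (μ := volume) (fun x => F x * ψ (x + -h)) h
  simp only [add_neg_cancel_right] at s1 s2
  rw [s1, s2]
  exact key

/-- identity with the true solution -/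
lemma energy_id {n : ℕ} {p q : ℝ} (hpq : p.HolderConjugate q)
    {G : EuclideanSpace ℝ (Fin n) → EuclideanSpace ℝ (Fin n)} {F : EuclideanSpace ℝ (Fin n) → ℝ}
    (hG : MemLp G (ENNReal.ofReal p) volume) (hF : MemLp F (ENNReal.ofReal p) volume)
    {x0 : EuclideanSpace ℝ (Fin n)} {R : ℝ} (hR : 0 < R)
    (heq : ∀ φ : EuclideanSpace ℝ (Fin n) → ℝ, ContDiff ℝ 1 φ → HasCompactSupport φ → tsupport φ ⊆ ball x0 (4*R) →
      ∫ x, ⟪G x, gradient φ x⟫ = ∫ x, F x * φ x)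
    {ζ : EuclideanSpace ℝ (Fin n) → ℝ} (hζ : ContDiff ℝ 1 ζ) (hζs : tsupport ζ ⊆ closedBall x0 (2*R))
    {w : EuclideanSpace ℝ (Fin n) → ℝ}
    {Dw : EuclideanSpace ℝ (Fin n) → EuclideanSpace ℝ (Fin n)}
    (hw : MemLp w (ENNReal.ofReal q) volume) (hDw : MemLp Dw (ENNReal.ofReal q) volume) (hW : WeakGrad n w Dw)
    {h : EuclideanSpace ℝ (Fin n)} (hh : ‖h‖ ≤ R) :
    (∫ x, (⟪(⟪G (x+h) - G x, gradient ζ x⟫ : ℝ), w (x+h) - w x⟫ : ℝ))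
     + ∫ x, ⟪ζ x • (G (x+h) - G x), Dw (x+h) - Dw x⟫
      = ∫ x, (⟪ζ x • (F (x+h) - F x), w (x+h) - w x⟫ : ℝ) := by
  have m : ∀ a b : ℝ, ⟪a, b⟫ = a * b := fun a b => by rw [real_inner_eq_re_inner]; simp [mul_comm]
  have hζcs : HasCompactSupport ζ := (isCompact_closedBall x0 (2*R)).of_isClosed_subset (isClosed_tsupport _) hζs
  obtain ⟨M, hM⟩ := hζ.continuous.bounded_above_of_compact_support hζcs
  obtain ⟨M', hM'⟩ := (grad_cont hζ).bounded_above_of_compact_support (grad_hcs hζcs)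
  have h1q : 1 ≤ ENNReal.ofReal q := by simpa using hpq.symm.lt.le
  have hτG := (memLp_translate hG h).sub hG
  have hτF := (memLp_translate hF h).sub hF
  have hA0 := memLp_inner_bdd hτG (grad_cont hζ).aestronglyMeasurable hM'
  have hA1 := memLp_smul_bdd hτG hζ.continuous.aestronglyMeasurable hM
  have hA2 := memLp_smul_bdd hτF hζ.continuous.aestronglyMeasurable hM
  obtain ⟨W, hc, h1, h2, t1, t2⟩ := approx hpq.symm.lt hw hDw hW
  have t1' := tau_tendsto h1q hw.1 (fun k => (h1 k).1) t1 h
  have t2' := tau_tendsto h1q hDw.1 (fun k => (h2 k).1) t2 h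
  have hτw := (memLp_translate hw h).sub hw
  have hτD := (memLp_translate hDw h).sub hDw
  have hτW := fun k => (memLp_translate (h1 k) h).sub (h1 k)
  have hτgW := fun k => (memLp_translate (h2 k) h).sub (h2 k)
  have l0 := pair_limit hpq hA0 hτw hτW t1'
  have l1 := pair_limit hpq hA1 hτD hτgW t2'
  have l2 := pair_limit hpq hA2 hτw hτW t1'
  refine tendsto_nhds_unique (l0.add l1) (l2.congr fun k => ?_)
  have := energy_smooth hpq hG hF hR heq hζ hζs (hc k) hh
  rw [← integral_add (pair_bound hpq hA0 (hτW k)).1 (pair_bound hpq hA1 (hτgW k)).1]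
  symm
  convert this using 1
  · congr 1; ext x
    simp only [m, Pi.sub_apply, inner_add_right, inner_smul_right, inner_smul_left]
    simp only [conj_trivial]
    ring
  · congr 1; ext x
    simp only [m, Pi.sub_apply, smul_eq_mul]
    ring


lemma enorm_rpow_real {r : ℝ} (hr : 0 < r) (a : ℝ) : ‖a‖ₑ^r = ENNReal.ofReal (|a|^r) := by
  rw [← ofReal_norm, ENNReal.ofReal_rpow_of_nonneg (norm_nonneg _) hr.le, Real.norm_eq_abs]

lemma integral_rpow_eq {X : Type*} [MeasurableSpace X] {μ : Measure X} {r : ℝ} (hr : 0 < r) {g : X → ℝ}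
    (hg : AEStronglyMeasurable g μ) : ∫ x, |g x|^r ∂μ = (eLpNorm g (ENNReal.ofReal r) μ).toReal^r := by
  rw [integral_eq_lintegral_of_nonneg_ae (Filter.Eventually.of_forall fun x => by positivity)
    (by simpa using (hg.norm.aemeasurable.pow_const r).aestronglyMeasurable)]
  simp_rw [← enorm_rpow_real hr]
  rw [lintegral_eq_eLpNorm_pow hr, ENNReal.toReal_rpow]

lemma eLpNorm_le_of_integral {X : Type*} [MeasurableSpace X] {μ : Measure X} {r : ℝ} (hr : 0 < r) {g : X → ℝ}
    (hg : MemLp g (ENNReal.ofReal r) μ) {S : ℝ} (hS : 0 ≤ S) (h : ∫ x, |g x|^r ∂μ ≤ S^r) :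
    eLpNorm g (ENNReal.ofReal r) μ ≤ ENNReal.ofReal S := by
  rw [integral_rpow_eq hr hg.1] at h
  rw [← ENNReal.ofReal_toReal hg.2.ne]
  exact ENNReal.ofReal_le_ofReal ((Real.rpow_le_rpow_iff ENNReal.toReal_nonneg hS hr).1 h)

lemma rpow_integrable {X : Type*} [MeasurableSpace X] {μ : Measure X} {r : ℝ} (hr : 0 < r) {g : X → ℝ}
    (hg : MemLp g (ENNReal.ofReal r) μ) : Integrable (fun x => |g x|^r) μ := by
  have := hg.integrable_norm_rpow (by simpa using hr) (by simp)
  simpa [ENNReal.toReal_ofReal hr.le] using this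

lemma energy_est {n : ℕ} {p q : ℝ} (hq1 : 1 < q) (hq2 : q < 2) (hp : p = q/(q-1))
    {F : EuclideanSpace ℝ (Fin n) → ℝ} (hF : MemLp F (ENNReal.ofReal p) volume)
    {w : EuclideanSpace ℝ (Fin n) → ℝ}
    {Dw : EuclideanSpace ℝ (Fin n) → EuclideanSpace ℝ (Fin n)}
    (hw : MemLp w (ENNReal.ofReal q) volume) (hDw : MemLp Dw (ENNReal.ofReal q) volume) (hW : WeakGrad n w Dw)
    {x0 : EuclideanSpace ℝ (Fin n)} {R : ℝ} (hR : 0 < R)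
    (heq : ∀ φ : EuclideanSpace ℝ (Fin n) → ℝ, ContDiff ℝ 1 φ → HasCompactSupport φ → tsupport φ ⊆ ball x0 (4*R) →
      ∫ x, ⟪Hmap n (q-1) (Dw x), gradient φ x⟫ = ∫ x, F x * φ x)
    {η : EuclideanSpace ℝ (Fin n) → ℝ} (hη : ContDiff ℝ 1 η) (hηs : tsupport η ⊆ closedBall x0 (2*R))
    (hη0 : ∀ x, 0 ≤ η x) (hη1 : ∀ x, η x ≤ 1) :
    ∃ K : ℝ, 0 ≤ K ∧ ∀ h : EuclideanSpace ℝ (Fin n), ‖h‖ ≤ R →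
      ∫ x, |η x * (vmap n q (Dw (x+h)) - vmap n q (Dw x))|^(2:ℝ) ≤
        1/(q-1) * (K * (eLpNorm (fun x => w (x+h) - w x) (ENNReal.ofReal q) volume).toReal^q
          + 2 * (eLpNorm (fun x => F (x+h) - F x) (ENNReal.ofReal p) (volume.restrict (closedBall x0 (2*R)))).toReal
            * (eLpNorm (fun x => w (x+h) - w x) (ENNReal.ofReal q) volume).toReal) := by
  have hpq : p.HolderConjugate q := by
    rw [hp]; exact (Real.HolderConjugate.conjExponent hq1).symm
  have hp2 : 2 ≤ p := by
    rw [hp, le_div_iff₀ (by linarith)]; linarith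
  have m : ∀ a b : ℝ, ⟪a, b⟫ = a * b := fun a b => by rw [real_inner_eq_re_inner]; simp [mul_comm]
  have hηcs : HasCompactSupport η := (isCompact_closedBall x0 (2*R)).of_isClosed_subset (isClosed_tsupport _) hηs
  obtain ⟨M, hM⟩ := (grad_cont hη).bounded_above_of_compact_support (grad_hcs hηcs)
  have hM0 : 0 ≤ M := (norm_nonneg _).trans (hM 0)
  set Ca : ℝ := 2^(p/2-1) * 4^(p/2-1) with hCa
  have hCa0 : 0 < Ca := by positivity
  obtain ⟨K, hK0, hK⟩ := young_eps hpq (c := 1/(2*Ca)) (M := 2*M) (by positivity) (by positivity)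
  refine ⟨2*K, by positivity, fun h hh => ?_⟩
  set ζ : EuclideanSpace ℝ (Fin n) → ℝ := fun x => η x * η x with hζ
  have hζc : ContDiff ℝ 1 ζ := hη.mul hη
  have hζs : tsupport ζ ⊆ closedBall x0 (2*R) := tsupport_mul_subset_left.trans hηs
  have hζcs : HasCompactSupport ζ := hηcs.mul_right
  obtain ⟨M', hM'⟩ := (grad_cont hζc).bounded_above_of_compact_support (grad_hcs hζcs)
  have hζ1 : ∀ x, ‖ζ x‖ ≤ 1 := fun x => by
    rw [Real.norm_of_nonneg (mul_self_nonneg _)]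
    have := hη0 x; have := hη1 x
    nlinarith
  have hG : MemLp (fun x => Hmap n (q-1) (Dw x)) (ENNReal.ofReal p) volume := Hmap_memLp hq1 hp hDw
  have key := energy_id hpq hG hF hR heq hζc hζs hw hDw hW hh
  set G := fun x => Hmap n (q-1) (Dw x) with hGdef
  have hτG : MemLp (fun x => G (x+h) - G x) (ENNReal.ofReal p) volume := (memLp_translate hG h).sub hG
  have hτF : MemLp (fun x => F (x+h) - F x) (ENNReal.ofReal p) volume := (memLp_translate hF h).sub hF
  have hτw : MemLp (fun x => w (x+h) - w x) (ENNReal.ofReal q) volume := (memLp_translate hw h).sub hw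
  have hτD : MemLp (fun x => Dw (x+h) - Dw x) (ENNReal.ofReal q) volume := (memLp_translate hDw h).sub hDw
  have hA0 := memLp_inner_bdd hτG (grad_cont hζc).aestronglyMeasurable hM'
  have hA1 := memLp_smul_bdd hτG hζc.continuous.aestronglyMeasurable hζ1
  have hA2 := memLp_smul_bdd hτF hζc.continuous.aestronglyMeasurable hζ1
  have i0 := (pair_bound hpq hA0 hτw).1
  have i1 := (pair_bound hpq hA1 hτD).1
  have i2 := pair_bound hpq hA2 hτw
  set b := (eLpNorm (fun x => w (x+h) - w x) (ENNReal.ofReal q) volume).toReal with hb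
  set a := (eLpNorm (fun x => F (x+h) - F x) (ENNReal.ofReal p) (volume.restrict (closedBall x0 (2*R)))).toReal with ha
  have hq0 : 0 < q := by linarith
  -- the right hand side
  have r2 : ∫ x, (⟪ζ x • (F (x+h) - F x), w (x+h) - w x⟫ : ℝ) ≤ a * b := by
    have e1 : eLpNorm (fun x => ζ x • (F (x+h) - F x)) (ENNReal.ofReal p) volume ≤
        eLpNorm (fun x => F (x+h) - F x) (ENNReal.ofReal p) (volume.restrict (closedBall x0 (2*R))) := by
      rw [← eLpNorm_indicator_eq_eLpNorm_restrict measurableSet_closedBall]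
      refine eLpNorm_mono fun x => ?_
      by_cases hx : x ∈ closedBall x0 (2*R)
      · rw [Set.indicator_of_mem hx, norm_smul]
        exact mul_le_of_le_one_left (norm_nonneg _) (hζ1 x)
      · have : ζ x = 0 := image_eq_zero_of_notMem_tsupport (fun hc => hx (hζs hc))
        rw [this]; simp
    have e2 : ‖∫ x, (⟪ζ x • (F (x+h) - F x), w (x+h) - w x⟫ : ℝ)‖ₑ ≤
        eLpNorm (fun x => F (x+h) - F x) (ENNReal.ofReal p) (volume.restrict (closedBall x0 (2*R))) *
         eLpNorm (fun x => w (x+h) - w x) (ENNReal.ofReal q) volume := by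
      refine (enorm_integral_le_lintegral_enorm _).trans ?_
      rw [← eLpNorm_one_eq_lintegral_enorm]
      refine i2.2.trans ?_
      gcongr
    have e3 := ENNReal.toReal_mono (ENNReal.mul_ne_top (hτF.restrict _).2.ne hτw.2.ne) e2
    rw [toReal_enorm, ENNReal.toReal_mul] at e3
    exact (le_abs_self _).trans e3
  -- pointwise
  have hI0 : ∀ x, 0 ≤ (⟪G (x+h) - G x, Dw (x+h) - Dw x⟫ : ℝ) := fun x => by
    have := mono_b n hq1 hq2 (Dw (x+h)) (Dw x)
    have h2 : 0 ≤ 1/(q-1) * (⟪G (x+h) - G x, Dw (x+h) - Dw x⟫ : ℝ) := (sq_nonneg _).trans this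
    exact nonneg_of_mul_nonneg_right h2 (by have : 0 < q - 1 := by linarith
                                            positivity)
  have pt : ∀ x, -(⟪(⟪G (x+h) - G x, gradient ζ x⟫ : ℝ), w (x+h) - w x⟫ : ℝ) ≤
      1/2 * ⟪ζ x • (G (x+h) - G x), Dw (x+h) - Dw x⟫ + K * |w (x+h) - w x|^q := by
    intro x
    have g1 : gradient ζ x = (2 * η x) • gradient η x := by
      rw [hζ, grad_mul hη hη, ← add_smul]; ring_nf
    have hη0x := hη0 x
    have n1 : ‖(⟪G (x+h) - G x, gradient ζ x⟫ : ℝ)‖ ≤ ‖G (x+h) - G x‖ * (2 * η x * M) := by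
      refine (norm_inner_le_norm _ _).trans ?_
      rw [g1, norm_smul, Real.norm_of_nonneg (by positivity)]
      gcongr
      exact hM x
    have n2 := hK (‖G (x+h) - G x‖ * η x) (|w (x+h) - w x|) (by positivity) (abs_nonneg _)
    have n3 : (‖G (x+h) - G x‖ * η x)^p ≤ Ca * (ζ x * (⟪G (x+h) - G x, Dw (x+h) - Dw x⟫ : ℝ)) := by
      rw [Real.mul_rpow (norm_nonneg _) hη0x]
      have z1 : η x ^ p ≤ ζ x := by
        have : η x ^ p ≤ η x ^ (2:ℝ) := Real.rpow_le_rpow_of_exponent_ge_of_imp hη0x (hη1 x) hp2 (by intro _ h0; linarith)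
        refine this.trans (le_of_eq ?_)
        rw [Real.rpow_two, sq]
      have z2 := mono_a n hq1 hq2 hp (Dw (x+h)) (Dw x)
      calc _ ≤ (Ca * (⟪G (x+h) - G x, Dw (x+h) - Dw x⟫ : ℝ)) * ζ x := by
            have := hI0 x
            gcongr
        _ = _ := by ring
    rw [inner_smul_left, m]
    simp only [conj_trivial]
    calc _ ≤ |(⟪G (x+h) - G x, gradient ζ x⟫ : ℝ)| * |w (x+h) - w x| := by
          rw [← abs_mul]; exact neg_le_abs _
      _ ≤ (‖G (x+h) - G x‖ * (2 * η x * M)) * |w (x+h) - w x| := by gcongr; exact n1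
      _ = 2*M*(‖G (x+h) - G x‖ * η x) * |w (x+h) - w x| := by ring
      _ ≤ _ := n2
      _ ≤ 1/(2*Ca) * (Ca * (ζ x * (⟪G (x+h) - G x, Dw (x+h) - Dw x⟫ : ℝ))) + K * |w (x+h) - w x|^q := by gcongr
      _ = _ := by field_simp
  have iw := rpow_integrable hq0 hτw
  have r0 : -∫ x, (⟪(⟪G (x+h) - G x, gradient ζ x⟫ : ℝ), w (x+h) - w x⟫ : ℝ) ≤
      1/2 * (∫ x, ⟪ζ x • (G (x+h) - G x), Dw (x+h) - Dw x⟫) + K * b^q := by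
    have e : b^q = ∫ x, |w (x+h) - w x|^q := by rw [integral_rpow_eq hq0 hτw.1]
    rw [e, ← integral_neg, ← integral_const_mul, ← integral_const_mul, ← integral_add (i1.const_mul _) (iw.const_mul _)]
    exact integral_mono i0.neg ((i1.const_mul _).add (iw.const_mul _)) pt
  have r3 : ∫ x, ⟪ζ x • (G (x+h) - G x), Dw (x+h) - Dw x⟫ ≤ 2*K*b^q + 2*a*b := by linarith
  have hq10 : 0 < q - 1 := by linarith
  calc _ ≤ ∫ x, 1/(q-1) * ⟪ζ x • (G (x+h) - G x), Dw (x+h) - Dw x⟫ := by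
        refine integral_mono_of_nonneg (Filter.Eventually.of_forall fun x => by positivity) (i1.const_mul _) (Filter.Eventually.of_forall fun x => ?_)
        simp only
        rw [Real.rpow_two, sq_abs, mul_pow, inner_smul_left]
        simp only [conj_trivial]
        have := mono_b n hq1 hq2 (Dw (x+h)) (Dw x)
        calc _ ≤ (η x)^2 * (1/(q-1) * ⟪G (x+h) - G x, Dw (x+h) - Dw x⟫) := by gcongr
          _ = _ := by simp only [hζ]; ring
    _ = 1/(q-1) * ∫ x, ⟪ζ x • (G (x+h) - G x), Dw (x+h) - Dw x⟫ := integral_const_mul _ _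
    _ ≤ _ := by gcongr


lemma unitVec_norm {n : ℕ} (s : Fin n) (t : ℝ) : ‖t • unitVec n s‖ = |t| := by
  rw [norm_smul, unitVec]; simp

lemma eLpNorm_le_of_integral2 {X : Type*} [MeasurableSpace X] {μ : Measure X} {g : X → ℝ}
    (hg : MemLp g 2 μ) {S : ℝ} (hS : 0 ≤ S) (h : ∫ x, |g x|^(2:ℝ) ∂μ ≤ S^(2:ℝ)) :
    eLpNorm g 2 μ ≤ ENNReal.ofReal S := by
  have e : (2:ℝ≥0∞) = ENNReal.ofReal 2 := by simp
  rw [e] at hg ⊢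
  exact eLpNorm_le_of_integral two_pos hg hS h

lemma tau_est {n : ℕ} {p q α : ℝ} (hq1 : 1 < q) (hq2 : q < 2) (hp : p = q/(q-1)) (hα : 0 < α) (hαq : α ≤ q - 1)
    {F : EuclideanSpace ℝ (Fin n) → ℝ} (hF : MemLp F (ENNReal.ofReal p) volume)
    {w : EuclideanSpace ℝ (Fin n) → ℝ}
    {Dw : EuclideanSpace ℝ (Fin n) → EuclideanSpace ℝ (Fin n)}
    (hw : MemLp w (ENNReal.ofReal q) volume) (hDw : MemLp Dw (ENNReal.ofReal q) volume) (hW : WeakGrad n w Dw)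
    {x0 : EuclideanSpace ℝ (Fin n)} {R : ℝ} (hR : 0 < R)
    (heq : ∀ φ : EuclideanSpace ℝ (Fin n) → ℝ, ContDiff ℝ 1 φ → HasCompactSupport φ → tsupport φ ⊆ ball x0 (4*R) →
      ∫ x, ⟪Hmap n (q-1) (Dw x), gradient φ x⟫ = ∫ x, F x * φ x)
    {η : EuclideanSpace ℝ (Fin n) → ℝ} (hη : ContDiff ℝ 1 η) (hηs : tsupport η ⊆ closedBall x0 (2*R))
    (hη0 : ∀ x, 0 ≤ η x) (hη1 : ∀ x, η x ≤ 1)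
    {A δ : ℝ} (hA : 0 ≤ A) (hδR : δ ≤ R) (hδ1 : δ ≤ 1)
    (hτ : ∀ s t, |t| ≤ δ → (eLpNorm (fun x => F (x+t • unitVec n s) - F x) (ENNReal.ofReal p)
      (volume.restrict (closedBall x0 (2*R)))).toReal ≤ A * |t|^α) :
    ∃ C : ℝ, 0 ≤ C ∧ ∀ s t, |t| ≤ δ →
      eLpNorm (fun x => η x * (vmap n q (Dw (x+t • unitVec n s)) - vmap n q (Dw x))) 2 volume ≤ ENNReal.ofReal (C * |t|^((1+α)/2)) := by
  obtain ⟨K, hK0, hK⟩ := energy_est hq1 hq2 hp hF hw hDw hW hR heq hη hηs hη0 hη1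
  set D := (eLpNorm Dw (ENNReal.ofReal q) volume).toReal with hD
  have hD0 : 0 ≤ D := ENNReal.toReal_nonneg
  have hq10 : 0 < q - 1 := by linarith
  set C := 1/(q-1) * (K * D^q + 2 * A * D) with hC
  have hC0 : 0 ≤ C := by positivity
  refine ⟨Real.sqrt C, Real.sqrt_nonneg _, fun s t ht => ?_⟩
  have hv := vmap_memLp hq1 hDw
  set h := t • unitVec n s with hh
  have hhn : ‖h‖ = |t| := unitVec_norm s t
  have hτv : MemLp (fun x => vmap n q (Dw (x+h)) - vmap n q (Dw x)) 2 volume := (memLp_translate hv h).sub hv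
  have hg : MemLp (fun x => η x * (vmap n q (Dw (x+h)) - vmap n q (Dw x))) 2 volume :=
    memLp_smul_bdd hτv hη.continuous.aestronglyMeasurable (M := 1) (fun x => by rw [Real.norm_of_nonneg (hη0 x)]; exact hη1 x)
  refine eLpNorm_le_of_integral2 hg (by positivity) ?_
  refine (hK h (by rw [hhn]; linarith)).trans ?_
  set a := (eLpNorm (fun x => F (x+h) - F x) (ENNReal.ofReal p) (volume.restrict (closedBall x0 (2*R)))).toReal with ha
  have ha0 : 0 ≤ a := ENNReal.toReal_nonneg
  have haA : a ≤ A * |t|^α := hτ s t ht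
  set b := (eLpNorm (fun x => w (x+h) - w x) (ENNReal.ofReal q) volume).toReal with hb
  have hb0 : 0 ≤ b := ENNReal.toReal_nonneg
  have hbD : b ≤ |t| * D := by
    have := ENNReal.toReal_mono (ENNReal.mul_ne_top (by simp) hDw.2.ne) (diff_quot hq1 hw hDw hW h)
    rwa [ENNReal.toReal_mul, toReal_enorm, hhn] at this
  have ht1 : |t| ≤ 1 := ht.trans hδ1
  have e1 : |t|^q ≤ |t|^(1+α) := Real.rpow_le_rpow_of_exponent_ge_of_imp (abs_nonneg _) ht1 (by linarith) (by intro _ h0; linarith)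
  have e2 : |t|^α * |t| = |t|^(1+α) := by
    rw [add_comm, Real.rpow_add_of_nonneg (abs_nonneg _) hα.le zero_le_one, Real.rpow_one]
  have e3 : (Real.sqrt C * |t|^((1+α)/2))^(2:ℝ) = C * |t|^(1+α) := by
    rw [Real.mul_rpow (Real.sqrt_nonneg _) (by positivity), Real.rpow_two, Real.sq_sqrt hC0, ← Real.rpow_mul (abs_nonneg _)]
    congr 2; ring
  rw [e3, hC]
  calc _ ≤ 1/(q-1) * (K * (|t| * D)^q + 2 * (A * |t|^α) * (|t| * D)) := by gcongr
    _ = 1/(q-1) * (K * (|t|^q*D^q) + 2 * A * (|t|^α * |t|) * D) := by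
        rw [Real.mul_rpow (abs_nonneg _) hD0]; ring
    _ ≤ 1/(q-1) * (K * (|t|^(1+α) * D^q) + 2 * A * (|t|^(1+α)) * D) := by rw [e2]; gcongr
    _ = _ := by ring

lemma local_core {n : ℕ} (hn : 2 ≤ n) {p q α : ℝ} (hq1 : 1 < q) (hq2 : q < 2) (hp : p = q/(q-1)) (hα : 0 < α) (hαq : α ≤ q - 1)
    {F : EuclideanSpace ℝ (Fin n) → ℝ} (hF : MemLp F (ENNReal.ofReal p) volume)
    {w : EuclideanSpace ℝ (Fin n) → ℝ}
    {Dw : EuclideanSpace ℝ (Fin n) → EuclideanSpace ℝ (Fin n)}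
    (hw : MemLp w (ENNReal.ofReal q) volume) (hDw : MemLp Dw (ENNReal.ofReal q) volume) (hW : WeakGrad n w Dw)
    {x0 : EuclideanSpace ℝ (Fin n)} {R : ℝ} (hR : 0 < R)
    (heq : ∀ φ : EuclideanSpace ℝ (Fin n) → ℝ, ContDiff ℝ 1 φ → HasCompactSupport φ → tsupport φ ⊆ ball x0 (4*R) →
      ∫ x, ⟪Hmap n (q-1) (Dw x), gradient φ x⟫ = ∫ x, F x * φ x)
    {A δ : ℝ} (hA : 0 ≤ A) (hδ : 0 < δ) (hδR : δ ≤ R) (hδ1 : δ ≤ 1)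
    (hτ : ∀ s t, |t| ≤ δ → (eLpNorm (fun x => F (x+t • unitVec n s) - F x) (ENNReal.ofReal p)
      (volume.restrict (closedBall x0 (2*R)))).toReal ≤ A * |t|^α)
    {r : ℝ} (hr : 1 ≤ r) (hrn : r < n * q / (n - α - 1)) :
    IntegrableOn (fun x => ‖Dw x‖^r) (ball x0 R) volume := by
  let η : ContDiffBump x0 := ⟨R, 2*R, hR, by linarith⟩
  have hηc : ContDiff ℝ 1 η := η.contDiff
  have hηs : tsupport η ⊆ closedBall x0 (2*R) := by rw [η.tsupport_eq]
  have hηcs : HasCompactSupport η := η.hasCompactSupport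
  have hη0 : ∀ x, 0 ≤ η x := fun x => η.nonneg
  have hη1 : ∀ x, η x ≤ 1 := fun x => η.le_one
  obtain ⟨C1, hC1, hE⟩ := tau_est hq1 hq2 hp hα hαq hF hw hDw hW hR heq hηc hηs hη0 hη1 hA hδR hδ1 hτ
  obtain ⟨L, hL⟩ := hηc.lipschitzWith_of_hasCompactSupport hηcs one_ne_zero
  have hv := vmap_memLp hq1 hDw
  set θ := (1+α)/2 with hθ
  have hθ0 : 0 < θ := by rw [hθ]; linarith
  have hθ1 : θ ≤ 1 := by rw [hθ]; linarith
  set V := (eLpNorm (fun x => vmap n q (Dw x)) 2 volume).toReal with hV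
  have hV0 : 0 ≤ V := ENNReal.toReal_nonneg
  have hVe : eLpNorm (fun x => vmap n q (Dw x)) 2 volume = ENNReal.ofReal V := (ENNReal.ofReal_toReal hv.2.ne).symm
  set g := fun x => η x * vmap n q (Dw x) with hg
  have hgL : MemLp g 2 volume := memLp_smul_bdd hv hηc.continuous.aestronglyMeasurable (M := 1)
      (fun x => by rw [Real.norm_of_nonneg (hη0 x)]; exact hη1 x)
  set N := (eLpNorm g 2 volume).toReal with hN
  have hN0 : 0 ≤ N := ENNReal.toReal_nonneg
  have hNe : eLpNorm g 2 volume = ENNReal.ofReal N := (ENNReal.ofReal_toReal hgL.2.ne).symm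
  have hnR : (2:ℝ) ≤ n := by exact_mod_cast hn
  have main : ∀ s t, eLpNorm (fun x => g (x+t•unitVec n s) - g x) 2 volume ≤
      ENNReal.ofReal ((C1 + L * V + 2*N*δ^(-θ)) * |t|^θ) := by
    intro s t
    set h := t • unitVec n s with hh
    have hhn : ‖h‖ = |t| := unitVec_norm s t
    by_cases ht : |t| ≤ δ
    · have e : (fun x => g (x+h) - g x) = fun x => η x * (vmap n q (Dw (x+h)) - vmap n q (Dw x)) + (η (x+h) - η x) * vmap n q (Dw (x+h)) := by
        ext x; simp only [hg]; ring
      rw [e]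
      have hvh := memLp_translate hv h
      have hηm : AEStronglyMeasurable η volume := hηc.continuous.aestronglyMeasurable
      refine (eLpNorm_add_le (hηm.mul (hvh.1.sub hv.1)) (((aesm_translate hηm h).sub hηm).mul hvh.1) one_le_two).trans ?_
      have b2 : eLpNorm (fun x => (η (x+h) - η x) * vmap n q (Dw (x+h))) 2 volume ≤ ENNReal.ofReal (L * V * |t|^θ) := by
        have : ∀ᵐ x, ‖(η (x+h) - η x) * vmap n q (Dw (x+h))‖ ≤ (L * |t|) * ‖vmap n q (Dw (x+h))‖ := by
          refine Filter.Eventually.of_forall fun x => ?_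
          rw [norm_mul]
          gcongr
          have := hL.norm_sub_le (x+h) x
          rwa [add_sub_cancel_left, hhn] at this
        refine (eLpNorm_le_mul_eLpNorm_of_ae_le_mul this 2).trans ?_
        rw [eLpNorm_translate hv.1 2 h, hVe, ← ENNReal.ofReal_mul (by positivity)]
        apply ENNReal.ofReal_le_ofReal
        have : |t| ≤ |t|^θ := by
          conv_lhs => rw [← Real.rpow_one |t|]
          exact Real.rpow_le_rpow_of_exponent_ge_of_imp (abs_nonneg _) (ht.trans hδ1) hθ1 (by intro _ h0; linarith)
        calc L * |t| * V = L * V * |t| := by ring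
          _ ≤ _ := by gcongr
      refine (add_le_add (hE s t ht) b2).trans ?_
      rw [← ENNReal.ofReal_add (by positivity) (by positivity)]
      apply ENNReal.ofReal_le_ofReal
      have : 0 ≤ 2*N*δ^(-θ) * |t|^θ := by positivity
      linarith
    · push Not at ht
      refine (eLpNorm_sub_le (aesm_translate hgL.1 h) hgL.1 one_le_two).trans ?_
      rw [eLpNorm_translate hgL.1 2 h, hNe, ← ENNReal.ofReal_add hN0 hN0]
      apply ENNReal.ofReal_le_ofReal
      have k1 : δ^θ ≤ |t|^θ := by gcongr
      have k2 : 1 ≤ δ^(-θ) * |t|^θ := by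
        calc 1 = δ^(-θ) * δ^θ := by rw [← Real.rpow_add hδ]; simp
          _ ≤ _ := by gcongr
      have k3 : 0 ≤ (C1 + L*V) * |t|^θ := by positivity
      nlinarith
  have h2θ : 2*θ = 1 + α := by rw [hθ]; ring
  have hden : 0 < (n:ℝ) - α - 1 := by linarith
  have hq0 : 0 < q := by linarith
  set r' := 2*r/q with hr'
  have hr'0 : 0 < r' := by positivity
  have hr'n : r' < 2*n/(n - 2*θ) := by
    rw [h2θ, hr', div_lt_div_iff₀ hq0 (by linarith)]
    rw [lt_div_iff₀ hden] at hrn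
    nlinarith
  have hE := embed n (by omega) hgL (by positivity) hθ0 (by rw [h2θ]; linarith) main hr'0 hr'n (B := ball x0 R) measure_ball_lt_top.ne
  have hvi : IntegrableOn (fun x => (vmap n q (Dw x))^r') (ball x0 R) volume := by
    refine ⟨(((vmap_meas n q).comp_aemeasurable hDw.1.aemeasurable).pow_const r').aestronglyMeasurable.restrict, ?_⟩
    rw [hasFiniteIntegral_iff_ofReal (Filter.Eventually.of_forall fun x => Real.rpow_nonneg (vmap_nonneg _ _ _) _)]
    refine lt_of_eq_of_lt (setLIntegral_congr_fun measurableSet_ball fun x hx => ?_) hE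
    simp only [hg]
    have : η x = 1 := η.one_of_mem_closedBall (ball_subset_closedBall hx)
    rw [this, one_mul, abs_of_nonneg (vmap_nonneg _ _ _)]
  have hdom : IntegrableOn (fun x => (2:ℝ)^r * (1 + (vmap n q (Dw x))^r')) (ball x0 R) volume :=
    ((integrableOn_const (measure_ball_lt_top.ne)).add hvi).const_mul _
  refine Integrable.mono' hdom ((hDw.1.norm.aemeasurable.pow_const r).aestronglyMeasurable.restrict) (Filter.Eventually.of_forall fun x => ?_)
  rw [Real.norm_of_nonneg (by positivity)]
  have v0 := vmap_nonneg n q (Dw x)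
  have k := norm_le_vmap n hq0 (Dw x)
  set y := (vmap n q (Dw x))^(2/q) with hy
  have hy0 : 0 ≤ y := by positivity
  have hyr : (vmap n q (Dw x))^r' = y^r := by
    rw [hy, ← Real.rpow_mul v0, hr']; congr 1; ring
  rw [hyr]
  have hr0 : 0 ≤ r := by linarith
  calc ‖Dw x‖^r ≤ (2 * max 1 y)^r := by
        gcongr
        linarith [le_max_left 1 y, le_max_right 1 y]
    _ = 2^r * (max 1 y)^r := Real.mul_rpow (by norm_num) (by positivity)
    _ ≤ _ := by
        gcongr
        rcases le_total 1 y with h | h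
        · rw [max_eq_right h]; linarith
        · rw [max_eq_left h, Real.one_rpow]; linarith [Real.rpow_nonneg hy0 r]


lemma memLp_of_supp {n : ℕ} {F : Type*} [NormedAddCommGroup F] {K : Set (EuclideanSpace ℝ (Fin n))} (hK : MeasurableSet K)
    {g : EuclideanSpace ℝ (Fin n) → F} {q : ℝ≥0∞} (hg : MemLp g q (volume.restrict K)) (h0 : ∀ x, x ∉ K → g x = 0) :
    MemLp g q volume := by
  rw [← memLp_indicator_iff_restrict hK] at hg
  have e : g = K.indicator g := by
    funext x
    by_cases hx : x ∈ K
    · rw [Set.indicator_of_mem hx]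
    · rw [Set.indicator_of_notMem hx, h0 x hx]
  rw [e]
  exact hg

lemma localize {n : ℕ} {q : ℝ} (hq : 1 < q) {Ω : Set (EuclideanSpace ℝ (Fin n))} 
    {u : EuclideanSpace ℝ (Fin n) → ℝ} {Du : EuclideanSpace ℝ (Fin n) → EuclideanSpace ℝ (Fin n)}
    (hu : MemW1Loc n q Ω u Du) {χ : EuclideanSpace ℝ (Fin n) → ℝ} (hχ : ContDiff ℝ 1 χ) (hχc : HasCompactSupport χ)
    (hχs : tsupport χ ⊆ Ω) :
    MemLp (fun x => χ x * u x) (ENNReal.ofReal q) volume ∧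
    MemLp (fun x => χ x • Du x + u x • gradient χ x) (ENNReal.ofReal q) volume ∧
    WeakGrad n (fun x => χ x * u x) (fun x => χ x • Du x + u x • gradient χ x) := by
  have hKm : MeasurableSet (tsupport χ) := (isClosed_tsupport _).measurableSet
  obtain ⟨huK, hDK⟩ := hu.1 (tsupport χ) hχc hχs
  obtain ⟨M, hM⟩ := hχ.continuous.bounded_above_of_compact_support hχc
  obtain ⟨M', hM'⟩ := (grad_cont hχ).bounded_above_of_compact_support (grad_hcs hχc)
  have h1q : 1 ≤ ENNReal.ofReal q := by simpa using hq.le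
  have m1 : MemLp (fun x => χ x * u x) (ENNReal.ofReal q) volume :=
    memLp_of_supp hKm (memLp_smul_bdd huK hχ.continuous.aestronglyMeasurable hM) fun x hx => by
      rw [image_eq_zero_of_notMem_tsupport hx, zero_mul]
  have m2 : MemLp (fun x => χ x • Du x) (ENNReal.ofReal q) volume :=
    memLp_of_supp hKm (memLp_smul_bdd hDK hχ.continuous.aestronglyMeasurable hM) fun x hx => by
      rw [image_eq_zero_of_notMem_tsupport hx, zero_smul]
  have m3 : MemLp (fun x => u x • gradient χ x) (ENNReal.ofReal q) volume := by
    refine memLp_of_supp hKm ?_ fun x hx => by rw [grad_supp hx, smul_zero]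
    refine MemLp.of_le_mul (c := M') huK (huK.1.smul (grad_cont hχ).aestronglyMeasurable) (Filter.Eventually.of_forall fun x => ?_)
    rw [norm_smul, mul_comm]
    gcongr
    exact hM' x
  refine ⟨m1, m2.add m3, fun φ hφ hφc => ?_⟩
  have key := hu.2 (fun x => χ x * φ x) (hχ.mul hφ) hφc.mul_left ((tsupport_mul_subset_left).trans hχs)
  rw [setIntegral_eq_integral_of_forall_compl_eq_zero, setIntegral_eq_integral_of_forall_compl_eq_zero] at key
  · have i1 : Integrable (fun x => (χ x * u x) • gradient φ x) volume :=
      (m1.locallyIntegrable h1q).integrable_smul_right_of_hasCompactSupport (grad_cont hφ) (grad_hcs hφc)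
    have i2 : Integrable (fun x => φ x • (χ x • Du x)) volume :=
      (m2.locallyIntegrable h1q).integrable_smul_left_of_hasCompactSupport hφ.continuous hφc
    have i3 : Integrable (fun x => φ x • (u x • gradient χ x)) volume :=
      (m3.locallyIntegrable h1q).integrable_smul_left_of_hasCompactSupport hφ.continuous hφc
    have e1 : (fun x => u x • gradient (fun x => χ x * φ x) x) = fun x => (χ x * u x) • gradient φ x + φ x • (u x • gradient χ x) := by
      ext1 x
      rw [grad_mul hχ hφ, smul_add, smul_smul, smul_comm (u x) (φ x), mul_comm (u x)]
    have e2 : (fun x => (χ x * φ x) • Du x) = fun x => φ x • (χ x • Du x) := by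
      ext1 x; rw [smul_smul, mul_comm]
    rw [e1, e2, integral_add i1 i3] at key
    simp_rw [smul_add]
    rw [integral_add i2 i3]
    rw [eq_sub_of_add_eq key]
    abel
  · intro x hx
    rw [image_eq_zero_of_notMem_tsupport (f := χ) (fun h => hx (hχs h)), zero_mul, zero_smul]
  · intro x hx
    have : x ∉ tsupport (fun x => χ x * φ x) := fun h => hx (hχs (tsupport_mul_subset_left h))
    rw [grad_supp this, smul_zero]

lemma local_concl {n : ℕ} (hn : 2 ≤ n) {p q α : ℝ} (hq1 : 1 < q) (hq2 : q < 2) (hp : p = q/(q-1)) (hα : 0 < α) (hαq : α ≤ q - 1)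
    {Ω : Set (EuclideanSpace ℝ (Fin n))} 
    {u : EuclideanSpace ℝ (Fin n) → ℝ} {Du : EuclideanSpace ℝ (Fin n) → EuclideanSpace ℝ (Fin n)}
    (hu : MemW1Loc n q Ω u Du)
    {F : EuclideanSpace ℝ (Fin n) → ℝ} (hF : MemLp F (ENNReal.ofReal p) volume)
    {x0 : EuclideanSpace ℝ (Fin n)} {R : ℝ} (hR : 0 < R) (hRΩ : closedBall x0 (5*R) ⊆ Ω)
    (heq : ∀ φ : EuclideanSpace ℝ (Fin n) → ℝ, ContDiff ℝ 1 φ → HasCompactSupport φ → tsupport φ ⊆ ball x0 (4*R) →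
      ∫ x in Ω, ⟪Hmap n (q-1) (Du x), gradient φ x⟫ = ∫ x, F x * φ x)
    {A δ : ℝ} (hA : 0 ≤ A) (hδ : 0 < δ) (hδR : δ ≤ R) (hδ1 : δ ≤ 1)
    (hτ : ∀ s t, |t| ≤ δ → (eLpNorm (fun x => F (x+t • unitVec n s) - F x) (ENNReal.ofReal p)
      (volume.restrict (closedBall x0 (2*R)))).toReal ≤ A * |t|^α)
    {r : ℝ} (hr : 1 ≤ r) (hrn : r < n * q / (n - α - 1)) :
    IntegrableOn (fun x => ‖Du x‖^r) (ball x0 R) volume := by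
  let χ : ContDiffBump x0 := ⟨4*R, 5*R, by linarith, by linarith⟩
  have hχ : ContDiff ℝ 1 χ := χ.contDiff
  have hχc : HasCompactSupport χ := χ.hasCompactSupport
  have hχs : tsupport χ ⊆ Ω := by rw [χ.tsupport_eq]; exact hRΩ
  obtain ⟨m1, m2, hW⟩ := localize hq1 hu hχ hχc hχs
  have hone : ∀ x ∈ ball x0 (4*R), χ x = 1 := fun x hx => χ.one_of_mem_closedBall (ball_subset_closedBall hx)
  have hgrad : ∀ x ∈ ball x0 (4*R), gradient χ x = 0 := fun x hx => by
    have : (χ : EuclideanSpace ℝ (Fin n) → ℝ) =ᶠ[nhds x] fun _ => 1 := by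
      filter_upwards [isOpen_ball.mem_nhds hx] with y hy using hone y hy
    rw [gradient, this.fderiv_eq]; simp
  have hD : ∀ x ∈ ball x0 (4*R), χ x • Du x + u x • gradient χ x = Du x := fun x hx => by
    rw [hone x hx, hgrad x hx, one_smul, smul_zero, add_zero]
  have hb : ball x0 (4*R) ⊆ Ω := (ball_subset_closedBall.trans (closedBall_subset_closedBall (by linarith))).trans hRΩ
  have := local_core hn hq1 hq2 hp hα hαq hF m1 m2 hW hR (fun φ h1 h2 h3 => by
    rw [← heq φ h1 h2 h3, setIntegral_eq_integral_of_forall_compl_eq_zero]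
    · congr 1; ext x
      by_cases hx : x ∈ ball x0 (4*R)
      · rw [hD x hx]
      · rw [grad_supp (fun h => hx (h3 h)), inner_zero_right, inner_zero_right]
    · intro x hx
      rw [grad_supp (fun h => hx (hb (h3 h))), inner_zero_right]) hA hδ hδR hδ1 hτ hr hrn
  refine this.congr_fun (fun x hx => ?_) measurableSet_ball
  simp only
  rw [hD x (ball_subset_ball (by linarith) hx)]

/-- either the right side is integrable against all test functions, or it can be replaced by zero -/
lemma dichotomy {n : ℕ} {p q : ℝ} (hq1 : 1 < q) (hp : p = q/(q-1))
    {Ω : Set (EuclideanSpace ℝ (Fin n))}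
    {u f : EuclideanSpace ℝ (Fin n) → ℝ} {Du : EuclideanSpace ℝ (Fin n) → EuclideanSpace ℝ (Fin n)}
    (hu : MemW1Loc n q Ω u Du) (hsol : IsLocalWeakSolution n q Ω Du f) :
    (∀ φ : EuclideanSpace ℝ (Fin n) → ℝ, ContDiff ℝ 1 φ → HasCompactSupport φ → tsupport φ ⊆ Ω →
      IntegrableOn (fun x => f x * φ x) Ω volume) ∨
    (∀ φ : EuclideanSpace ℝ (Fin n) → ℝ, ContDiff ℝ 1 φ → HasCompactSupport φ → tsupport φ ⊆ Ω →
      ∫ x in Ω, ⟪Hmap n (q-1) (Du x), gradient φ x⟫ = 0) := by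
  have hpq : p.HolderConjugate q := by
    rw [hp]; exact (Real.HolderConjugate.conjExponent hq1).symm
  by_cases H : ∀ φ : EuclideanSpace ℝ (Fin n) → ℝ, ContDiff ℝ 1 φ → HasCompactSupport φ → tsupport φ ⊆ Ω →
      IntegrableOn (fun x => f x * φ x) Ω volume
  · exact Or.inl H
  right
  push Not at H
  obtain ⟨φ0, a1, a2, a3, a4⟩ := H
  have hI : ∀ φ : EuclideanSpace ℝ (Fin n) → ℝ, ContDiff ℝ 1 φ → HasCompactSupport φ → tsupport φ ⊆ Ω →
      IntegrableOn (fun x => (⟪Hmap n (q-1) (Du x), gradient φ x⟫ : ℝ)) Ω volume := by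
    intro φ h1 h2 h3
    have hG := Hmap_memLp hq1 hp (hu.1 (tsupport φ) h2 h3).2
    have hg : MemLp (gradient φ) (ENNReal.ofReal q) volume := (grad_cont h1).memLp_of_hasCompactSupport (grad_hcs h2)
    have := (pair_bound hpq hG (hg.restrict (tsupport φ))).1
    have h5 := (integrableOn_iff_integrable_of_support_subset (μ := volume) (s := tsupport φ)
      (f := fun x => (⟪Hmap n (q-1) (Du x), gradient φ x⟫ : ℝ)) (fun x hx => by
        by_contra hc
        apply hx
        simp only
        rw [grad_supp hc, inner_zero_right])).1 this
    exact h5.integrableOn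
  intro φ h1 h2 h3
  by_cases hi : IntegrableOn (fun x => f x * φ x) Ω volume
  · have z0 : ∫ x in Ω, ⟪Hmap n (q-1) (Du x), gradient φ0 x⟫ = 0 := by
      rw [hsol φ0 a1 a2 a3]; exact integral_undef a4
    have hsub : tsupport (fun x => φ0 x - φ x) ⊆ Ω := (tsupport_sub φ0 φ).trans (Set.union_subset a3 h3)
    have z1 : ∫ x in Ω, ⟪Hmap n (q-1) (Du x), gradient (fun x => φ0 x - φ x) x⟫ = 0 := by
      rw [hsol _ (a1.sub h1) (a2.sub h2) hsub]
      refine integral_undef fun hc => a4 ?_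
      have := hc.add hi
      refine this.congr (Filter.Eventually.of_forall fun x => ?_)
      simp only [Pi.add_apply]; ring
    simp_rw [grad_sub a1 h1, inner_sub_right] at z1
    rw [integral_sub (hI φ0 a1 a2 a3) (hI φ h1 h2 h3), z0] at z1
    linarith
  · rw [hsol φ h1 h2 h3]; exact integral_undef hi


lemma case_one {n : ℕ} (hn : 2 ≤ n) {p q α : ℝ} (hq1 : 1 < q) (hq2 : q < 2) (hp : p = q/(q-1)) (hα : 0 < α) (hαq : α ≤ q - 1)
    {Ω : Set (EuclideanSpace ℝ (Fin n))} 
    {u f : EuclideanSpace ℝ (Fin n) → ℝ} {Du Df : EuclideanSpace ℝ (Fin n) → EuclideanSpace ℝ (Fin n)}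
    (hu : MemW1Loc n q Ω u Du) (hsol : IsLocalWeakSolution n q Ω Du f) (hf : MemW1Loc n p Ω f Df)
    {x0 : EuclideanSpace ℝ (Fin n)} {R : ℝ} (hR : 0 < R) (hRΩ : closedBall x0 (6*R) ⊆ Ω)
    {r : ℝ} (hr : 1 ≤ r) (hrn : r < n * q / (n - α - 1)) :
    IntegrableOn (fun x => ‖Du x‖^r) (ball x0 R) volume := by
  have hp1 : 1 < p := by
    rw [hp, lt_div_iff₀ (by linarith)]; linarith
  let χ : ContDiffBump x0 := ⟨4*R, 5*R, by linarith, by linarith⟩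
  have hχ : ContDiff ℝ 1 χ := χ.contDiff
  have hχc : HasCompactSupport χ := χ.hasCompactSupport
  have h5 : closedBall x0 (5*R) ⊆ Ω := (closedBall_subset_closedBall (by linarith)).trans hRΩ
  have hχs : tsupport χ ⊆ Ω := by rw [χ.tsupport_eq]; exact h5
  obtain ⟨m1, m2, hW⟩ := localize hp1 hf hχ hχc hχs
  have hone : ∀ x ∈ ball x0 (4*R), χ x = 1 := fun x hx => χ.one_of_mem_closedBall (ball_subset_closedBall hx)
  have hb : ball x0 (4*R) ⊆ Ω := (ball_subset_closedBall.trans (closedBall_subset_closedBall (by linarith))).trans hRΩ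
  refine local_concl hn hq1 hq2 hp hα hαq hu m1 hR h5 (fun φ h1 h2 h3 => ?_)
    (A := (eLpNorm (fun x => χ x • Df x + f x • gradient χ x) (ENNReal.ofReal p) volume).toReal) (δ := min R 1)
    ENNReal.toReal_nonneg (lt_min hR one_pos) (min_le_left _ _) (min_le_right _ _) (fun s t ht => ?_) hr hrn
  · rw [hsol φ h1 h2 (h3.trans hb), setIntegral_eq_integral_of_forall_compl_eq_zero]
    · congr 1; ext x
      by_cases hx : x ∈ ball x0 (4*R)
      · rw [hone x hx, one_mul]
      · rw [image_eq_zero_of_notMem_tsupport (f := φ) (fun h => hx (h3 h)), mul_zero, mul_zero]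
    · intro x hx
      rw [image_eq_zero_of_notMem_tsupport (f := φ) (fun h => hx (hb (h3 h))), mul_zero]
  · have ht1 : |t| ≤ 1 := ht.trans (min_le_right _ _)
    have k := (eLpNorm_restrict_le _ _ volume (closedBall x0 (2*R))).trans (diff_quot hp1 m1 m2 hW (t • unitVec n s))
    have k2 := ENNReal.toReal_mono (ENNReal.mul_ne_top (by simp) m2.2.ne) k
    rw [ENNReal.toReal_mul, toReal_enorm, unitVec_norm] at k2
    refine k2.trans ?_
    rw [mul_comm |t|]
    gcongr
    conv_lhs => rw [← Real.rpow_one |t|]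
    exact Real.rpow_le_rpow_of_exponent_ge_of_imp (abs_nonneg _) ht1 (by linarith) (by intro _ h0; linarith)

lemma case_two {n : ℕ} (hn : 2 ≤ n) {p q α α' : ℝ} (hq1 : 1 < q) (hq2 : q < 2) (hp : p = q/(q-1)) (hα : 0 < α) (hαq : α ≤ q - 1)
    (hαα : α ≤ α')
    {Ω : Set (EuclideanSpace ℝ (Fin n))} 
    {u f : EuclideanSpace ℝ (Fin n) → ℝ} {Du : EuclideanSpace ℝ (Fin n) → EuclideanSpace ℝ (Fin n)}
    (hu : MemW1Loc n q Ω u Du) (hsol : IsLocalWeakSolution n q Ω Du f) (hf : MemBesovLoc n p α' Ω f)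
    {x0 : EuclideanSpace ℝ (Fin n)} {R : ℝ} (hR : 0 < R) (hRΩ : closedBall x0 (6*R) ⊆ Ω)
    {r : ℝ} (hr : 1 ≤ r) (hrn : r < n * q / (n - α - 1)) :
    IntegrableOn (fun x => ‖Du x‖^r) (ball x0 R) volume := by
  have hp1 : 1 < p := by
    rw [hp, lt_div_iff₀ (by linarith)]; linarith
  have hp0 : 0 < p := by linarith
  have h5 : closedBall x0 (5*R) ⊆ Ω := (closedBall_subset_closedBall (by linarith)).trans hRΩ
  have hb : ball x0 (4*R) ⊆ Ω := (ball_subset_closedBall.trans (closedBall_subset_closedBall (by linarith))).trans hRΩ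
  have hb5 : ball x0 (5*R) ⊆ Ω := ball_subset_closedBall.trans h5
  rcases dichotomy hq1 hp hu hsol with H | H
  · -- measurability of f
    let χ : ContDiffBump x0 := ⟨5*R, 6*R, by linarith, by linarith⟩
    have hfm : AEStronglyMeasurable f (volume.restrict (ball x0 (5*R))) := by
      have := H χ χ.contDiff χ.hasCompactSupport (by rw [χ.tsupport_eq]; exact hRΩ)
      have h1 := (this.mono_set hb5).1
      refine h1.congr ?_
      filter_upwards [ae_restrict_mem measurableSet_ball] with x hx
      rw [χ.one_of_mem_closedBall (ball_subset_closedBall hx), mul_one]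
    have hfL : MemLp f (ENNReal.ofReal p) (volume.restrict (ball x0 (5*R))) := by
      rw [← integrable_norm_rpow_iff hfm (by simpa using hp0) (by simp), ENNReal.toReal_ofReal hp0.le]
      exact (hf x0 (5*R) (by linarith) h5).1
    set F := (ball x0 (5*R)).indicator f with hFdef
    have hF : MemLp F (ENNReal.ofReal p) volume := (memLp_indicator_iff_restrict measurableSet_ball).2 hfL
    obtain ⟨M, hM⟩ := (hf x0 (3*R) (by linarith) ((closedBall_subset_closedBall (by linarith)).trans hRΩ)).2
    refine local_concl hn hq1 hq2 hp hα hαq hu hF hR h5 (fun φ h1 h2 h3 => ?_)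
      (A := max M 0) (δ := min R 1)
      (le_max_right _ _) (lt_min hR one_pos) (min_le_left _ _) (min_le_right _ _) (fun s t ht => ?_) hr hrn
    · rw [hsol φ h1 h2 (h3.trans hb), setIntegral_eq_integral_of_forall_compl_eq_zero]
      · congr 1; ext x
        by_cases hx : x ∈ ball x0 (4*R)
        · rw [hFdef, Set.indicator_of_mem (ball_subset_ball (by linarith) hx)]
        · rw [image_eq_zero_of_notMem_tsupport (f := φ) (fun h => hx (h3 h)), mul_zero, mul_zero]
      · intro x hx
        rw [image_eq_zero_of_notMem_tsupport (f := φ) (fun h => hx (hb (h3 h))), mul_zero]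
    · have ht1 : |t| ≤ 1 := ht.trans (min_le_right _ _)
      have htR : |t| ≤ R := ht.trans (min_le_left _ _)
      by_cases ht0 : t = 0
      · rw [ht0]; simp [hα.ne']
      set h := t • unitVec n s with hh
      have hhn : ‖h‖ = |t| := unitVec_norm s t
      have hτF : MemLp (fun x => F (x+h) - F x) (ENNReal.ofReal p) volume := (memLp_translate hF h).sub hF
      have htp : 0 < |t| := abs_pos.2 ht0
      have b1 : (∫ x in ball x0 (3*R), |f (x + h) - f x| ^ p / |t| ^ (α' * p)) ^ (1 / p) ≤ M := hM ⟨s, t, ht0, rfl⟩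
      have b2 : ∫ x in ball x0 (3*R), |f (x + h) - f x| ^ p / |t| ^ (α' * p) =
          (eLpNorm (fun x => F (x+h) - F x) (ENNReal.ofReal p) (volume.restrict (ball x0 (3*R)))).toReal^p / |t|^(α'*p) := by
        rw [← integral_rpow_eq hp0 hτF.1.restrict, ← integral_div]
        refine setIntegral_congr_fun measurableSet_ball fun x hx => ?_
        rw [mem_ball] at hx
        have y1 : x ∈ ball x0 (5*R) := by rw [mem_ball]; linarith
        have y2 : x + h ∈ ball x0 (5*R) := by
          rw [mem_ball]
          have := dist_triangle (x+h) x x0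
          have h2 : dist (x+h) x = ‖h‖ := by simp
          linarith
        rw [hFdef, Set.indicator_of_mem y1, Set.indicator_of_mem y2]
      set N := (eLpNorm (fun x => F (x+h) - F x) (ENNReal.ofReal p) (volume.restrict (ball x0 (3*R)))).toReal with hN
      have hN0 : 0 ≤ N := ENNReal.toReal_nonneg
      have b3 : N ≤ M * |t|^α' := by
        rw [b2, Real.rpow_mul htp.le, ← Real.div_rpow hN0 (by positivity), ← Real.rpow_mul (by positivity), mul_one_div_cancel hp0.ne', Real.rpow_one,
          div_le_iff₀ (by positivity)] at b1
        exact b1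
      have b4 : (eLpNorm (fun x => F (x+h) - F x) (ENNReal.ofReal p) (volume.restrict (closedBall x0 (2*R)))).toReal ≤ N := by
        refine ENNReal.toReal_mono (hτF.restrict _).2.ne ?_
        exact eLpNorm_mono_measure _ (Measure.restrict_mono (closedBall_subset_ball (by linarith)) le_rfl)
      have b5 : |t|^α' ≤ |t|^α := Real.rpow_le_rpow_of_exponent_ge htp ht1 hαα
      calc _ ≤ _ := b4
        _ ≤ _ := b3
        _ ≤ max M 0 * |t|^α' := by gcongr; exact le_max_left _ _
        _ ≤ _ := by gcongr
  · refine local_concl hn hq1 hq2 hp hα hαq hu (F := fun _ => 0) MemLp.zero hR h5 (fun φ h1 h2 h3 => ?_)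
      (A := 0) (δ := min R 1)
      le_rfl (lt_min hR one_pos) (min_le_left _ _) (min_le_right _ _) (fun s t ht => ?_) hr hrn
    · rw [H φ h1 h2 (h3.trans hb)]; simp
    · simp

lemma cover {n : ℕ} {Ω : Set (EuclideanSpace ℝ (Fin n))} (hΩ : IsOpen Ω) {g : EuclideanSpace ℝ (Fin n) → ℝ}
    (h : ∀ x0 R, 0 < R → closedBall x0 (6*R) ⊆ Ω → IntegrableOn g (ball x0 R) volume)
    {K : Set (EuclideanSpace ℝ (Fin n))} (hK : IsCompact K) (hKΩ : K ⊆ Ω) : IntegrableOn g K volume := by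
  have : LocallyIntegrableOn g K volume := by
    intro x hx
    obtain ⟨ε, hε, hb⟩ := Metric.nhds_basis_closedBall.mem_iff.1 (hΩ.mem_nhds (hKΩ hx))
    exact ⟨ball x (ε/6), mem_nhdsWithin_of_mem_nhds (ball_mem_nhds x (by positivity)),
      h x (ε/6) (by positivity) (by rwa [mul_div_cancel₀ _ (by norm_num)])⟩
  exact this.integrableOn_isCompact hK

theorem stmt5 (n : ℕ) (hn : 2 ≤ n) (q p α : ℝ) (hq1 : 1 < q) (hq2 : q < 2)
    (hp : p = q / (q - 1)) (hα1 : 0 < α) (hα2 : α < 1)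
    (Ω : Set (EuclideanSpace ℝ (Fin n))) (hΩo : IsOpen Ω) (hΩb : Bornology.IsBounded Ω)
    (u f : EuclideanSpace ℝ (Fin n) → ℝ)
    (Du : EuclideanSpace ℝ (Fin n) → EuclideanSpace ℝ (Fin n))
    (hu : MemW1Loc n q Ω u Du)
    (hsol : IsLocalWeakSolution n q Ω Du f) :
    ((∃ Df : EuclideanSpace ℝ (Fin n) → EuclideanSpace ℝ (Fin n), MemW1Loc n p Ω f Df) →
      ∀ r : ℝ, 1 ≤ r → r < (n : ℝ) * q * (3 - q) / ((n : ℝ) * (3 - q) - 2) →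
        ∀ K : Set (EuclideanSpace ℝ (Fin n)), IsCompact K → K ⊆ Ω →
          IntegrableOn (fun x => ‖Du x‖ ^ r) K volume) ∧
    (MemBesovLoc n p α Ω f →
      ∀ s : ℝ, 1 ≤ s →
        ((α < (q - 1) / (3 - q) ∧ s < (n : ℝ) * q / ((n : ℝ) - α - 1)) ∨
          ((q - 1) / (3 - q) ≤ α ∧ s < (n : ℝ) * q * (3 - q) / ((n : ℝ) * (3 - q) - 2))) →
        ∀ K : Set (EuclideanSpace ℝ (Fin n)), IsCompact K → K ⊆ Ω →
          IntegrableOn (fun x => ‖Du x‖ ^ s) K volume) := by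
  have h3q : 0 < 3 - q := by linarith
  set β := (q-1)/(3-q) with hβ
  have hβ0 : 0 < β := div_pos (by linarith) h3q
  have hβq : β ≤ q - 1 := by
    rw [hβ, div_le_iff₀ h3q]; nlinarith
  have hnR : (2:ℝ) ≤ n := by exact_mod_cast hn
  have hexp : (n : ℝ) * q * (3 - q) / ((n : ℝ) * (3 - q) - 2) = n * q / (n - β - 1) := by
    have e : (n:ℝ) - β - 1 = ((n : ℝ) * (3 - q) - 2)/(3-q) := by
      rw [hβ]; field_simp; ring
    rw [e, div_div_eq_mul_div]
  rw [hexp]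
  constructor
  · rintro ⟨Df, hf⟩ r hr hrn K hK hKΩ
    exact cover hΩo (fun x0 R hR hRΩ => case_one hn hq1 hq2 hp hβ0 hβq hu hsol hf hR hRΩ hr hrn) hK hKΩ
  · rintro hf s hs (⟨h1, h2⟩ | ⟨h1, h2⟩) K hK hKΩ
    · exact cover hΩo (fun x0 R hR hRΩ => case_two hn hq1 hq2 hp hα1 (h1.le.trans hβq) le_rfl hu hsol hf hR hRΩ hs h2) hK hKΩ
    · exact cover hΩo (fun x0 R hR hRΩ => case_two hn hq1 hq2 hp hβ0 hβq h1 hu hsol hf hR hRΩ hs h2) hK hKΩ
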